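/- arXiv:2209.06891 — 3 statements merged into one kernel-verified Lean document; each statement's English description precedes it below -/
import Mathlib

section
/- Let w be a finite word over the alphabet {a,b} of the form w = a^{r_1} b a^{r_2} b a^{r_3} b ... a^{r_k} b a^{r_{k+1}}, where k ≥ 1, r_1, ..., r_{k+1} are nonnegative integers, and at least one r_j is positive (so both letters a and b occur in w). Let σ be a permutation of {1, 2, ..., k+1} such that r_{σ(1)} ≤ r_{σ(2)} ≤ ... ≤ r_{σ(k+1)}. Then m(w) + r_{σ(k)} ≤ |w| − 2. -/
/-- `numPowers w` is the number of distinct nonempty factors of `w` that are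
powers of exponent at least 2, i.e. of the form `u^j` with `u` nonempty and `j ≥ 2`. -/
noncomputable def numPowers {α : Type*} (w : List α) : ℕ :=
  Set.ncard {v : List α | v <:+: w ∧
    ∃ u : List α, u ≠ [] ∧ ∃ j : ℕ, 2 ≤ j ∧ v = (List.replicate j u).flatten}

/-- `numSquares w` is the number of distinct squares occurring as factors of `w`. -/
noncomputable def numSquares {α : Type*} (w : List α) : ℕ :=
  Set.ncard {v : List α | v <:+: w ∧ ∃ u : List α, u ≠ [] ∧ v = u ++ u}

/-- The binary word `a^{r 0} b a^{r 1} b ⋯ a^{r (k-1)} b a^{r k}` over the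
alphabet `Bool`, where `a := false` and `b := true`. -/
def binWord (k : ℕ) (r : Fin (k + 1) → ℕ) : List Bool :=
  (List.ofFn (fun j : Fin k => List.replicate (r j.castSucc) false ++ [true])).flatten
    ++ List.replicate (r (Fin.last k)) false

open Finset Relation

/-- The word `f i, f (i+1), …, f (i+n-1)` read off an infinite sequence `f`. -/
def window {α : Type*} (f : ℕ → α) (i n : ℕ) : List α :=
  (List.range n).map fun t => f (i + t)

section Window

variable {α : Type*} (f g : ℕ → α) (i j m n : ℕ)

@[simp] lemma length_window : (window f i n).length = n := by simp [window]

variable {f g i j n} in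
lemma window_eq_window_iff : window f i n = window g j n ↔ ∀ t < n, f (i + t) = g (j + t) := by
  simp [window, List.map_inj_left]

lemma window_add : window f i (m + n) = window f i m ++ window f (i + m) n := by
  simp [window, List.range_add, add_assoc]

@[simp] lemma window_one : window f i 1 = [f i] := by simp [window]

lemma dropLast_window_succ : (window f i (n + 1)).dropLast = window f i n := by
  simp [window_add]

lemma tail_window_succ : (window f i (n + 1)).tail = window f (i + 1) n := by
  rw [add_comm n 1, window_add]; simp

variable {i j m n} in
lemma window_infix_window (h : j ≤ i) (h' : i + n ≤ j + m) : window f i n <:+: window f j m := by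
  obtain ⟨p, rfl⟩ := Nat.exists_eq_add_of_le h
  obtain ⟨q, hq⟩ := Nat.exists_eq_add_of_le h'
  obtain rfl : m = p + n + q := by omega
  exact ⟨window f j p, window f (j + (p + n)) q, by rw [window_add, window_add]⟩

lemma window_getD (w : List α) (a : α) : window (fun t => w.getD t a) 0 w.length = w := by
  apply List.ext_getElem <;> simp +contextual [window]

end Window

section Factors

variable {α : Type*} [DecidableEq α]

/-- The factors of length `n` of the word `window g 0 N`. -/
def factorsOfLength (g : ℕ → α) (N n : ℕ) : Finset (List α) :=
  (range (N + 1 - n)).image fun i => window g i n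

lemma window_mem_factorsOfLength {g : ℕ → α} {N n i : ℕ} (h : i + n ≤ N) :
    window g i n ∈ factorsOfLength g N n :=
  mem_image_of_mem _ (by simp; omega)

lemma mem_factorsOfLength {g : ℕ → α} {N n : ℕ} {v : List α} :
    v ∈ factorsOfLength g N n ↔ v.length = n ∧ v <:+: window g 0 N := by
  constructor
  · intro h
    obtain ⟨i, hi, rfl⟩ := mem_image.1 h
    rw [mem_range] at hi
    exact ⟨by simp, window_infix_window g (by omega) (by omega)⟩
  · rintro ⟨rfl, s, t, h⟩
    have hl := congrArg List.length h
    simp only [List.length_append, length_window] at hl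
    obtain rfl : N = s.length + v.length + t.length := by omega
    rw [window_add, window_add] at h
    obtain ⟨h, -⟩ := List.append_inj h (by simp)
    obtain ⟨-, h⟩ := List.append_inj h (by simp)
    rw [h, length_window]
    exact window_mem_factorsOfLength (by omega)

end Factors

lemma eqvGen_of_chain {β : Type*} {R : β → β → Prop} (h : ℕ → β) {a b : ℕ} (hab : a ≤ b)
    (H : ∀ x, a ≤ x → x < b → EqvGen R (h x) (h (x + 1))) : EqvGen R (h a) (h b) := by
  induction b, hab using Nat.le_induction with
  | base => exact .refl _
  | succ b hb ih =>
    exact (ih fun x h1 h2 => H x h1 (by omega)).trans _ _ _ (H b hb (by omega))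

/-- A connected graph on `V` with edge set `E` has at least `#V - 1` edges. -/
lemma card_le_card_add_one_of_eqvGen {β : Type*} [DecidableEq β] (V : Finset β)
    (E : Finset (β × β))
    (h : ∀ u ∈ V, ∀ v ∈ V, EqvGen (fun x y => (x, y) ∈ E) u v) : #V ≤ #E + 1 := by
  induction hn : #E using Nat.strong_induction_on generalizing V E with
  | _ n ih =>
  subst hn
  rcases E.eq_empty_or_nonempty with rfl | ⟨⟨x, y⟩, hxy⟩
  · simp only [card_empty, zero_add, card_le_one]
    have key : ∀ {p q : β}, EqvGen (fun x y : β => (x, y) ∈ (∅ : Finset (β × β))) p q →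
        p = q := by
      intro p q hpq
      induction hpq with
      | rel _ _ h => simp at h
      | refl => rfl
      | symm _ _ _ ih => exact ih.symm
      | trans _ _ _ _ _ h1 h2 => exact h1.trans h2
    exact fun u hu v hv => key (h u hu v hv)
  · set φ : β → β := fun z => if z = y then x else z with hφ
    set E' := (E.erase (x, y)).image (Prod.map φ φ)
    have hE : #E' < #E := card_image_le.trans_lt (card_erase_lt_of_mem hxy)
    have key : ∀ {p q : β}, EqvGen (fun x y : β => (x, y) ∈ E) p q →
        EqvGen (fun x y => (x, y) ∈ E') (φ p) (φ q) := by
      intro p q hpq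
      induction hpq with
      | rel a b hab =>
        by_cases hc : (a, b) = (x, y)
        · obtain ⟨rfl, rfl⟩ := Prod.mk.inj hc
          have : φ a = φ b := by simp [hφ]
          rw [this]; exact .refl _
        · exact .rel _ _ (mem_image.2 ⟨(a, b), mem_erase.2 ⟨hc, hab⟩, rfl⟩)
      | refl => exact .refl _
      | symm _ _ _ ih => exact ih.symm
      | trans _ _ _ _ _ h1 h2 => exact h1.trans _ _ _ h2
    have h1 : #(V.image φ) ≤ #E' + 1 := by
      refine ih _ hE _ E' ?_ rfl
      simp only [mem_image]
      rintro _ ⟨u, hu, rfl⟩ _ ⟨v, hv, rfl⟩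
      exact key (h u hu v hv)
    have h2 : V ⊆ insert y (V.image φ) := by
      intro v hv
      by_cases hvy : v = y
      · simp [hvy]
      · exact mem_insert_of_mem (mem_image.2 ⟨v, hv, by simp [hφ, hvy]⟩)
    have := (card_le_card h2).trans (card_insert_le _ _)
    omega

/-- `f` has least positive period `d` and is lexicographically least among its shifts. -/
structure IsLyndonSeq (f : ℕ → Bool) (d : ℕ) : Prop where
  pos : 0 < d
  periodic : Function.Periodic f d
  minimal : ∀ d', 0 < d' → d' < d → ¬ Function.Periodic f d'
  le_shift : ∀ i, toLex f ≤ toLex fun x => f (x + i)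

lemma toLex_shift_le {f g : ℕ → Bool} {m : ℕ} (h : toLex f ≤ toLex g)
    (hm : ∀ x < m, f x = g x) :
    (toLex fun x => f (x + m)) ≤ toLex fun x => g (x + m) := by
  rcases h.eq_or_lt with h | ⟨i, hi, hlt⟩
  · rw [toLex_inj.1 h]
  · change ∀ j < i, f j = g j at hi
    change f i < g i at hlt
    have him : m ≤ i := by
      by_contra hc
      exact hlt.ne (hm i (by omega))
    refine le_of_lt ⟨i - m, fun j hj => hi _ (by omega), ?_⟩
    change f (i - m + m) < g (i - m + m)
    rwa [Nat.sub_add_cancel him]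

/-- Lyndon words are unbordered. -/
lemma IsLyndonSeq.not_border {f : ℕ → Bool} {d d' : ℕ} (hf : IsLyndonSeq f d) (h0 : 0 < d')
    (hd : d' < d) : ¬ ∀ x, x + d' < d → f x = f (x + d') := by
  intro h
  have h1 := toLex_shift_le (m := d - d') (hf.le_shift d') fun x hx => h x (by omega)
  have h2 : (fun x => f (x + (d - d') + d')) = f := by
    funext x
    rw [add_assoc, Nat.sub_add_cancel hd.le]
    exact hf.periodic x
  rw [h2] at h1
  exact hf.minimal (d - d') (by omega) (by omega)
    (congrFun (toLex_inj.1 (h1.antisymm (hf.le_shift _))))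

lemma IsLyndonSeq.period_le_of_window_eq {f g : ℕ → Bool} {d d' i n : ℕ} (hf : IsLyndonSeq f d)
    (hd : d ≤ n) (hg : Function.Periodic g d') (h0 : 0 < d')
    (h : window g i n = window f 0 n) : d ≤ d' := by
  by_contra hc
  rw [window_eq_window_iff] at h
  simp only [zero_add] at h
  refine hf.not_border h0 (by omega) fun x hx => ?_
  rw [← h x (by omega), ← h (x + d') (by omega), ← add_assoc, hg]

lemma eq_shift_of_window_eq {f g : ℕ → Bool} {d i n : ℕ} (hf : Function.Periodic f d) (h0 : 0 < d)
    (hd : d ≤ n) (hg : Function.Periodic g d) (h : window g i n = window f 0 n) :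
    f = fun x => g (x + i) := by
  rw [window_eq_window_iff] at h
  simp only [zero_add] at h
  have hg' : Function.Periodic (fun x => g (x + i)) d := fun x => by
    simp only
    rw [add_right_comm]; exact hg _
  funext x
  rw [← hf.map_mod_nat, ← hg'.map_mod_nat x, ← h _ ((Nat.mod_lt _ h0).trans_le hd), add_comm]

lemma IsLyndonSeq.eq_of_window_eq {f g : ℕ → Bool} {d d' n : ℕ} (hf : IsLyndonSeq f d)
    (hg : IsLyndonSeq g d') (hd : d ≤ n) (hd' : d' ≤ n) (h : window f 0 n = window g 0 n) :
    f = g ∧ d = d' := by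
  obtain rfl : d = d' := le_antisymm
    (hf.period_le_of_window_eq hd hg.periodic hg.pos h.symm)
    (hg.period_le_of_window_eq hd' hf.periodic hf.pos h)
  exact ⟨eq_shift_of_window_eq hf.periodic hf.pos hd hg.periodic h.symm, rfl⟩

lemma window_ne_replicate_append {f : ℕ → Bool} {d i n : ℕ} (hf : Function.Periodic f d)
    (h0 : 0 < d) (hd : d ≤ n) : window f i (n + 1) ≠ List.replicate n false ++ [true] := by
  intro h
  rw [window_add, window_one] at h
  obtain ⟨h1, h2⟩ := List.append_inj h (by simp)
  have h3 : f (i + (n - d)) = false := by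
    refine List.eq_of_mem_replicate (n := n) (h1 ▸ ?_)
    exact List.mem_map.2 ⟨n - d, by simp; omega, rfl⟩
  have h4 := hf (i + (n - d))
  rw [add_assoc, Nat.sub_add_cancel hd, h3] at h4
  simp [h4] at h2

/-- The cyclomatic bound for the graph whose vertices and edges are the factors of lengths `n` and
`n + 1`: deleting one edge from each cycle of length at most `n`, and the edge `a^n b` if it lies
on a cycle, leaves a connected graph. -/
lemma card_factors_add_card_le (g : ℕ → Bool) (N n : ℕ) (F : Finset (List Bool))
    (hFE : F ⊆ factorsOfLength g N (n + 1))
    (hF : ∀ e ∈ F, (∃ f d, IsLyndonSeq f d ∧ d ≤ n ∧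
        (∀ i, window f i (n + 1) ∈ factorsOfLength g N (n + 1)) ∧ e = window f 0 (n + 1)) ∨
      (e = List.replicate n false ++ [true] ∧ ∃ i j, i < j ∧ j + n ≤ N ∧
        window g i (n + 1) = List.replicate n false ++ [true] ∧
        window g j n = List.replicate n false)) :
    #(factorsOfLength g N n) + #F ≤ #(factorsOfLength g N (n + 1)) + 1 := by
  set E := (factorsOfLength g N (n + 1) \ F).image fun e => (e.dropLast, e.tail) with hE
  have hcard : #E + #F ≤ #(factorsOfLength g N (n + 1)) := by
    have := card_sdiff_add_card_eq_card hFE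
    have : #E ≤ _ := card_image_le
    omega
  have hrel : ∀ (f : ℕ → Bool) x, window f x (n + 1) ∈ factorsOfLength g N (n + 1) →
      window f x (n + 1) ∉ F →
      EqvGen (fun x y => (x, y) ∈ E) (window f x n) (window f (x + 1) n) := by
    intro f x h1 h2
    refine .rel _ _ (mem_image.2 ⟨_, mem_sdiff.2 ⟨h1, h2⟩, ?_⟩)
    rw [dropLast_window_succ, tail_window_succ]
  have hcyc : ∀ d f, IsLyndonSeq f d → d ≤ n →
      (∀ i, window f i (n + 1) ∈ factorsOfLength g N (n + 1)) →
      EqvGen (fun x y => (x, y) ∈ E) (window f 0 n) (window f 1 n) := by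
    intro d
    induction d using Nat.strong_induction_on with
    | _ d ih =>
    intro f hf hd hmem
    have hloop : window f d n = window f 0 n :=
      window_eq_window_iff.2 fun t _ => by rw [add_comm, hf.periodic, zero_add]
    rw [← hloop]
    refine (eqvGen_of_chain (fun x => window f x n) hf.pos fun x hx hxd => ?_).symm
    by_cases hxF : window f x (n + 1) ∈ F
    · rcases hF _ hxF with ⟨f', d', hf', hd', hmem', heq⟩ | ⟨heq, -⟩
      · have h1 := hf'.period_le_of_window_eq (by omega) hf.periodic hf.pos heq
        rcases h1.lt_or_eq with h1 | rfl
        · have h2 := ih d' h1 f' hf' hd' hmem'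
          rw [← dropLast_window_succ f', ← tail_window_succ f' 0, ← heq, dropLast_window_succ,
            tail_window_succ] at h2
          exact h2
        · have h2 := eq_shift_of_window_eq hf'.periodic hf.pos (by omega) hf.periodic heq
          have h3 := hf'.le_shift (d' - x)
          have h4 : (fun y => f' (y + (d' - x))) = f := by
            funext y
            rw [h2]
            simp only
            rw [add_assoc, Nat.sub_add_cancel hxd.le]
            exact hf.periodic y
          rw [h4, h2] at h3
          exact absurd (congrFun (toLex_inj.1 (h3.antisymm (hf.le_shift x))))
            (hf.minimal x (by omega) hxd)
      · exact absurd heq (window_ne_replicate_append hf.periodic hf.pos hd)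
    · exact hrel f x (hmem x) hxF
  have hstep : ∀ x, x + (n + 1) ≤ N → window g x (n + 1) ≠ List.replicate n false ++ [true] →
      EqvGen (fun x y => (x, y) ∈ E) (window g x n) (window g (x + 1) n) := by
    intro x hx hne
    by_cases hxF : window g x (n + 1) ∈ F
    · rcases hF _ hxF with ⟨f, d, hf, hd, hmem, heq⟩ | ⟨heq, -⟩
      · have h2 := hcyc d f hf hd hmem
        rw [← dropLast_window_succ f, ← tail_window_succ f 0, ← heq, dropLast_window_succ,
          tail_window_succ] at h2
        exact h2
      · exact absurd heq hne
    · exact hrel g x (window_mem_factorsOfLength hx) hxF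
  have hab : ∀ k i j, j - i = k → i < j → j + n ≤ N →
      window g i (n + 1) = List.replicate n false ++ [true] →
      window g j n = List.replicate n false →
      EqvGen (fun x y => (x, y) ∈ E) (List.replicate n false)
        (List.replicate n false ++ [true]).tail := by
    intro k
    induction k using Nat.strong_induction_on with
    | _ k ih =>
    intro i j hk hij hj hi hjn
    by_cases hex : ∃ x, i < x ∧ x < j ∧ window g x (n + 1) = List.replicate n false ++ [true]
    · obtain ⟨x, h1, h2, h3⟩ := hex
      exact ih (j - x) (by omega) x j rfl h2 hj h3 hjn
    · push Not at hex
      rw [← hi, tail_window_succ, ← hjn]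
      exact (eqvGen_of_chain (fun x => window g x n) hij fun x h1 h2 =>
        hstep x (by omega) (hex x (by omega) h2)).symm
  have hall : ∀ x, x + (n + 1) ≤ N →
      EqvGen (fun x y => (x, y) ∈ E) (window g x n) (window g (x + 1) n) := by
    intro x hx
    by_cases hxF : window g x (n + 1) ∈ F
    · by_cases hne : window g x (n + 1) = List.replicate n false ++ [true]
      · rcases hF _ hxF with ⟨f, d, hf, hd, hmem, heq⟩ | ⟨heq, i, j, hij, hj, hi, hjn⟩
        · exact absurd (heq ▸ hne) (window_ne_replicate_append hf.periodic hf.pos hd)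
        · have h2 := hab _ i j rfl hij hj hi hjn
          rw [← hne, tail_window_succ] at h2
          convert h2
          rw [← dropLast_window_succ, hne, List.dropLast_concat]
      · exact hstep x hx hne
    · exact hrel g x (window_mem_factorsOfLength hx) hxF
  have hconn : ∀ u ∈ factorsOfLength g N n, ∀ v ∈ factorsOfLength g N n,
      EqvGen (fun x y => (x, y) ∈ E) u v := by
    have h0 : ∀ u ∈ factorsOfLength g N n,
        EqvGen (fun x y => (x, y) ∈ E) (window g 0 n) u := by
      intro u hu
      obtain ⟨i, hi, rfl⟩ := mem_image.1 hu
      rw [mem_range] at hi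
      exact eqvGen_of_chain (fun x => window g x n) (Nat.zero_le i) fun x _ h => hall x (by omega)
    exact fun u hu v hv => (h0 u hu).symm.trans _ _ _ (h0 v hv)
  have := card_le_card_add_one_of_eqvGen _ E hconn
  omega

lemma exists_isLyndonSeq_shift {h : ℕ → Bool} {D : ℕ} (hD : 0 < D) (hh : Function.Periodic h D) :
    ∃ f d i, IsLyndonSeq f d ∧ i < d ∧ d ∣ D ∧ h = fun x => f (x + i) := by
  classical
  have hex : ∃ d, 0 < d ∧ Function.Periodic h d := ⟨D, hD, hh⟩
  obtain ⟨d, ⟨h0, hd⟩, hmin⟩ : ∃ d, (0 < d ∧ Function.Periodic h d) ∧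
      ∀ d' < d, ¬ (0 < d' ∧ Function.Periodic h d') :=
    ⟨Nat.find hex, Nat.find_spec hex, fun _ => Nat.find_min hex⟩
  obtain ⟨i, hi, hle⟩ := exists_min_image (range d) (fun i => toLex fun x => h (x + i))
    ⟨0, by simpa using h0⟩
  rw [mem_range] at hi
  have hback : h = fun x => h (x + (d - i) % d + i) := by
    funext x
    rw [← hd.map_mod_nat (x + (d - i) % d + i), ← hd.map_mod_nat x]
    congr 1
    rw [add_right_comm, Nat.add_mod_mod, add_assoc, Nat.add_sub_cancel' hi.le, Nat.add_mod_right]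
  refine ⟨fun x => h (x + i), d, (d - i) % d, ⟨h0, fun x => ?_, fun d' h1 h2 hp => ?_, fun j => ?_⟩,
    Nat.mod_lt _ h0, ?_, hback⟩
  · rw [add_right_comm]; exact hd _
  · refine hmin d' h2 ⟨h1, fun x => ?_⟩
    rw [hback]
    simp only
    rw [add_right_comm x d']
    exact hp _
  · convert hle ((j + i) % d) (by simpa using Nat.mod_lt _ h0) using 2
    funext x
    rw [← hd.map_mod_nat (x + j + i), ← hd.map_mod_nat (x + _)]
    simp [add_assoc]
  · by_contra hc
    refine hmin (D % d) (Nat.mod_lt _ h0)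
      ⟨Nat.pos_of_ne_zero fun h => hc (Nat.dvd_of_mod_eq_zero h), fun x => ?_⟩
    rw [← hd.map_mod_nat, Nat.add_mod_mod, hd.map_mod_nat]
    exact hh x

lemma flatten_replicate_eq_window {α : Type*} (u : List α) (a : α) (j : ℕ) :
    (List.replicate j u).flatten =
      window (fun x => u.getD (x % u.length) a) 0 (j * u.length) := by
  induction j with
  | zero => simp [window]
  | succ j ih =>
    rw [List.replicate_succ, List.flatten_cons, ih, add_mul, one_mul, add_comm (j * _), window_add]
    congr 1
    · conv_lhs => rw [← window_getD u a]
      exact window_eq_window_iff.2 fun t ht => by simp [Nat.mod_eq_of_lt ht]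
    · exact window_eq_window_iff.2 fun t _ => by simp

lemma exists_isLyndonSeq_of_power {u : List Bool} (hu : u ≠ []) {j : ℕ} (hj : 2 ≤ j) :
    ∃ f d i k, IsLyndonSeq f d ∧ i < d ∧ 2 ≤ k ∧
      (List.replicate j u).flatten = window f i (k * d) := by
  obtain ⟨f, d, i, hf, hi, ⟨c, hc⟩, heq⟩ := exists_isLyndonSeq_shift
    (h := fun x => u.getD (x % u.length) false) (List.length_pos_iff.2 hu) fun x => by simp
  refine ⟨f, d, i, j * c, hf, hi, ?_, ?_⟩
  · have : 0 < c := by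
      rcases Nat.eq_zero_or_pos c with rfl | h
      · simp [hu] at hc
      · exact h
    nlinarith
  · rw [flatten_replicate_eq_window u false, heq, hc, mul_assoc, mul_comm c d]
    exact window_eq_window_iff.2 fun t _ => by rw [zero_add, add_comm]

open Classical in
/-- If `c` of the `d` cyclic windows of length `k * d` are factors of `w`, then all windows of
length `(k - 1) * d + c` are. -/
lemma window_infix_of_count {f : ℕ → Bool} {d k i : ℕ} {w : List Bool}
    (hf : Function.Periodic f d) (hi : i < d) (hk : 1 ≤ k) (hw : window f i (k * d) <:+: w)
    (x : ℕ) :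
    window f x ((k - 1) * d + Nat.count (fun y => window f y (k * d) <:+: w) i + 1) <:+: w := by
  set p : ℕ → Prop := fun y => window f y (k * d) <:+: w with hp
  set r := Nat.count p i with hr
  have hpp : Function.Periodic p d := fun y => by
    simp only [hp]
    rw [show window f (y + d) (k * d) = window f y (k * d) from
      window_eq_window_iff.2 fun t _ => by rw [add_right_comm]; exact hf _]
  have hlt : r < Nat.count p d := Nat.count_strict_mono hw hi
  have hrd : r < d := hlt.trans_le (Nat.count_le _)
  obtain ⟨y, hy1, hy2, hy⟩ : ∃ y, x + r + 1 ≤ y ∧ y ≤ x + d ∧ p y := by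
    by_contra! hc
    have h1 := Nat.filter_Ico_card_eq_of_periodic (x + 1) d p hpp
    have h2 : (Ico (x + 1) (x + 1 + d)).filter p ⊆ Ico (x + 1) (x + r + 1) := by
      intro y hy
      rw [mem_filter, mem_Ico] at hy
      rw [mem_Ico]
      refine ⟨hy.1.1, ?_⟩
      by_contra h
      exact hc y (by omega) (by omega) hy.2
    have h3 := card_le_card h2
    rw [Nat.card_Ico] at h3
    omega
  have h1 : window f x ((k - 1) * d + r + 1) = window f (x + d) ((k - 1) * d + r + 1) :=
    window_eq_window_iff.2 fun t _ => by rw [add_right_comm, hf]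
  rw [h1]
  obtain ⟨k, rfl⟩ := Nat.exists_eq_add_of_le' hk
  refine (window_infix_window f hy2 ?_).trans hy
  simp only [Nat.add_sub_cancel]
  nlinarith

/-- A set of factors of lengths at least `2`, each level of which satisfies the cyclomatic bound,
has at most `N - #factorsOfLength g N 1` elements. -/
lemma card_add_card_factors_one_le (g : ℕ → Bool) (N : ℕ) (F : Finset (List Bool))
    (hlen : ∀ e ∈ F, 2 ≤ e.length ∧ e.length ≤ N)
    (h : ∀ n, 1 ≤ n → #(factorsOfLength g N n) + #(F.filter fun e => e.length = n + 1) ≤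
      #(factorsOfLength g N (n + 1)) + 1) :
    #F + #(factorsOfLength g N 1) ≤ N := by
  have hsum : ∀ M, ∑ m ∈ range M, #(F.filter fun e => e.length - 2 = m) +
      #(factorsOfLength g N 1) ≤ #(factorsOfLength g N (M + 1)) + M := by
    intro M
    induction M with
    | zero => simp
    | succ M ih =>
      have h1 := h (M + 1) (by omega)
      have h2 : F.filter (fun e => e.length - 2 = M) =
          F.filter fun e => e.length = M + 1 + 1 :=
        filter_congr fun e he => by have := hlen e he; omega
      rw [sum_range_succ, h2]
      omega
  have h1 := card_eq_sum_card_fiberwise (s := F) (t := range N) (f := fun e => e.length - 2)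
    fun e he => by have := hlen e he; simp; omega
  have h2 := hsum N
  rw [← h1] at h2
  simpa [factorsOfLength] using h2

/-- If both letters occur in `w`, and `a^n b ⋯ a^n` is a factor of `w` for all `n ≤ s`, then `w` has
at most `|w| - 2 - s` factors that are powers. -/
theorem numPowers_add_le {w : List Bool} {s : ℕ} (ht : true ∈ w) (hf : false ∈ w)
    (hs : ∀ n ≤ s, ∃ X Y Z, w = X ++ List.replicate n false ++ [true] ++ Y ++
      List.replicate n false ++ Z) :
    numPowers w + s + 2 ≤ w.length := by
  classical
  set g : ℕ → Bool := fun t => w.getD t false with hg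
  set N := w.length with hN
  have hgw : window g 0 N = w := window_getD w false
  have hmem : ∀ {n v}, v ∈ factorsOfLength g N n ↔ v.length = n ∧ v <:+: w := by
    intro n v
    rw [mem_factorsOfLength, hgw]
  set P : Set (List Bool) := {v : List Bool | v <:+: w ∧
    ∃ u : List Bool, u ≠ [] ∧ ∃ j : ℕ, 2 ≤ j ∧ v = (List.replicate j u).flatten} with hP
  have hPfin : P.Finite := by
    refine (Set.Finite.subset ((range (N + 1)).biUnion (factorsOfLength g N)).finite_toSet ?_)
    rintro v ⟨hv, -⟩
    simp only [coe_biUnion, Set.mem_iUnion, mem_coe, hmem]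
    exact ⟨v.length, by simpa [Nat.lt_succ_iff] using hv.length_le, rfl, hv⟩
  have hdata : ∀ v ∈ P, ∃ f d i k, IsLyndonSeq f d ∧ i < d ∧ 2 ≤ k ∧ v = window f i (k * d) := by
    rintro v ⟨-, u, hu, j, hj, rfl⟩
    exact exists_isLyndonSeq_of_power hu hj
  choose! f d i k hL hi hk hv using hdata
  set n : List Bool → ℕ := fun v =>
    (k v - 1) * d v + Nat.count (fun y => window (f v) y (k v * d v) <:+: w) (i v) with hn
  have hdn : ∀ v ∈ P, d v ≤ n v := fun v hvP => by
    have := hk v hvP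
    exact (Nat.le_mul_of_pos_left _ (by omega)).trans (Nat.le_add_right _ _)
  have hwin : ∀ v ∈ P, ∀ x, window (f v) x (n v + 1) <:+: w := fun v hvP x =>
    window_infix_of_count (hL v hvP).periodic (hi v hvP) (by have := hk v hvP; omega)
      (hv v hvP ▸ hvP.1) x
  set Φ : List Bool → List Bool := fun v => window (f v) 0 (n v + 1) with hΦ
  have hinj : Set.InjOn Φ P := by
    intro v hvP v' hvP' heq
    have hnn : n v = n v' := by simpa [hΦ] using congrArg List.length heq
    have heq' : window (f v) 0 (n v + 1) = window (f v') 0 (n v + 1) := by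
      conv_rhs => rw [hnn]
      exact heq
    have hd1 := hdn v hvP
    have hd2 := hdn v' hvP'
    obtain ⟨hff, hdd⟩ := (hL v hvP).eq_of_window_eq (hL v' hvP') (by omega) (by omega) heq'
    have hr := (Nat.count_le fun y => window (f v) y (k v * d v) <:+: w).trans_lt (hi v hvP)
    have hr' := (Nat.count_le fun y => window (f v') y (k v' * d v') <:+: w).trans_lt
      (hi v' hvP')
    have h0 := (hL v hvP).pos
    have hkk : k v = k v' := by
      have h1 : n v / d v = k v - 1 := by
        rw [hn]
        simp only
        rw [add_comm, Nat.add_mul_div_right _ _ h0, Nat.div_eq_of_lt hr, zero_add]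
      have h2 : n v' / d v' = k v' - 1 := by
        rw [hn]
        simp only
        rw [add_comm, Nat.add_mul_div_right _ _ (hdd ▸ h0), Nat.div_eq_of_lt hr', zero_add]
      rw [← hnn, ← hdd, h1] at h2
      have := hk v hvP
      have := hk v' hvP'
      omega
    have hii : i v = i v' := by
      have h1 := hnn
      simp only [hn, ← hff, ← hdd, ← hkk, Nat.add_left_cancel_iff] at h1
      refine Nat.count_injective (p := fun y => window (f v) y (k v * d v) <:+: w) ?_ ?_ h1
      · exact hv v hvP ▸ hvP.1
      · have := hvP'.1
        rw [hv v' hvP', ← hff, ← hdd, ← hkk] at this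
        exact this
    rw [hv v hvP, hv v' hvP', hff, hdd, hkk, hii]
  set A : ℕ → List Bool := fun m => List.replicate (m + 1) false ++ [true] with hA
  set F := hPfin.toFinset.image Φ ∪ (range s).image A with hF
  have hFcard : #F = numPowers w + s := by
    rw [hF, card_union_of_disjoint, card_image_of_injOn (by simpa using hinj),
      card_image_of_injective, card_range, numPowers, Set.ncard_eq_toFinset_card _ hPfin]
    · intro m m' h
      simpa [hA] using congrArg List.length h
    · simp only [disjoint_left, mem_image, hPfin.mem_toFinset, mem_range, not_exists, not_and]
      rintro _ ⟨v, hvP, rfl⟩ m hm h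
      have hl : m + 1 = n v := by simpa [hA, hΦ] using congrArg List.length h
      refine window_ne_replicate_append (hL v hvP).periodic (hL v hvP).pos (hdn v hvP)
        (i := 0) (h.symm.trans ?_)
      rw [hA, ← hl]
  have hpos : ∀ m ≤ s, ∃ p q, p < q ∧ q + m ≤ N ∧
      window g p (m + 1) = List.replicate m false ++ [true] ∧
      window g q m = List.replicate m false := by
    intro m hm
    obtain ⟨X, Y, Z, h⟩ := hs m hm
    have hl : N = X.length + (m + 1) + Y.length + m + Z.length := by
      rw [hN, h]; simp; omega
    have h' := hgw
    rw [hl, window_add, window_add, window_add, window_add, h, List.append_assoc X] at h'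
    obtain ⟨h', -⟩ := List.append_inj h' (by simp; omega)
    obtain ⟨h', h2⟩ := List.append_inj h' (by simp; omega)
    obtain ⟨h', -⟩ := List.append_inj h' (by simp)
    obtain ⟨-, h1⟩ := List.append_inj h' (by simp)
    exact ⟨_, _, by omega, by omega, h1, h2⟩
  have hFmem : ∀ e ∈ F, e <:+: w ∧ 2 ≤ e.length := by
    intro e he
    rcases mem_union.1 he with he | he
    · obtain ⟨v, hvP, rfl⟩ := mem_image.1 he
      rw [hPfin.mem_toFinset] at hvP
      refine ⟨hwin v hvP 0, ?_⟩
      have := hdn v hvP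
      have := (hL v hvP).pos
      simp [hΦ]; omega
    · obtain ⟨m, hm, rfl⟩ := mem_image.1 he
      rw [mem_range] at hm
      obtain ⟨X, Y, Z, h⟩ := hs (m + 1) hm
      exact ⟨⟨X, Y ++ List.replicate (m + 1) false ++ Z, by rw [h]; simp [hA]⟩, by simp [hA]⟩
  have hbound := card_add_card_factors_one_le g N F
    (fun e he => ⟨(hFmem e he).2, (hFmem e he).1.length_le⟩) fun m _ => by
      refine card_factors_add_card_le g N m _ (fun e he => ?_) fun e he => ?_
      · rw [mem_filter] at he
        exact hmem.2 ⟨he.2, (hFmem e he.1).1⟩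
      · obtain ⟨he, hl⟩ := mem_filter.1 he
        rcases mem_union.1 he with he | he
        · obtain ⟨v, hvP, rfl⟩ := mem_image.1 he
          rw [hPfin.mem_toFinset] at hvP
          obtain rfl : n v = m := by simpa [hΦ] using hl
          exact .inl ⟨f v, d v, hL v hvP, hdn v hvP, fun x => hmem.2 ⟨by simp, hwin v hvP x⟩, rfl⟩
        · obtain ⟨m', hm', rfl⟩ := mem_image.1 he
          rw [mem_range] at hm'
          obtain rfl : m' + 1 = m := by simpa [hA] using hl
          exact .inr ⟨rfl, hpos _ hm'⟩
  have htwo : #({[false], [true]} : Finset (List Bool)) ≤ #(factorsOfLength g N 1) := by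
    refine card_le_card fun v hv => hmem.2 ?_
    simp only [mem_insert, mem_singleton] at hv
    rcases hv with rfl | rfl
    · exact ⟨rfl, (List.singleton_infix_iff _ _).2 hf⟩
    · exact ⟨rfl, (List.singleton_infix_iff _ _).2 ht⟩
  rw [card_pair (by simp)] at htwo
  omega

lemma true_mem_binWord {k : ℕ} (hk : 1 ≤ k) (r : Fin (k + 1) → ℕ) : true ∈ binWord k r := by
  simp only [binWord, List.mem_append, List.mem_flatten, List.mem_ofFn]
  exact .inl ⟨_, ⟨⟨0, hk⟩, rfl⟩, by simp⟩

lemma false_mem_binWord {k : ℕ} {r : Fin (k + 1) → ℕ} (h : ∃ j, 0 < r j) :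
    false ∈ binWord k r := by
  obtain ⟨j, hj⟩ := h
  simp only [binWord, List.mem_append, List.mem_flatten, List.mem_ofFn]
  induction j using Fin.lastCases with
  | last => exact .inr (by simp; omega)
  | cast j => exact .inl ⟨_, ⟨j, rfl⟩, by simp; omega⟩

/-- The runs of `a`s indexed by `p < q` occur in this order, separated by a `b`. -/
lemma exists_binWord_eq {k : ℕ} (r : Fin (k + 1) → ℕ) {p q : Fin (k + 1)} (h : p < q) :
    ∃ X Y Z, binWord k r = X ++ List.replicate (r p) false ++ [true] ++ Y ++
      List.replicate (r q) false ++ Z := by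
  obtain ⟨p, rfl⟩ := Fin.exists_castSucc_eq.2 (h.trans_le (Fin.le_last q)).ne
  set L := List.ofFn fun j : Fin k => List.replicate (r j.castSucc) false ++ [true] with hL
  have hlen : L.length = k := by simp [hL]
  have hLp : L = L.take p ++ (List.replicate (r p.castSucc) false ++ [true]) ::
      L.drop (p + 1) := by
    conv_lhs => rw [← List.take_append_drop p L, List.drop_eq_getElem_cons (by omega)]
    simp [hL]
  induction q using Fin.lastCases with
  | last =>
    refine ⟨(L.take p).flatten, (L.drop (p + 1)).flatten, [], ?_⟩
    rw [binWord, ← hL]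
    conv_lhs => rw [hLp]
    simp
  | cast q =>
    have hpq : p.val < q.val := h
    have hq : List.replicate (r q.castSucc) false ++ [true] ∈ L.drop (p + 1) := by
      refine List.mem_iff_getElem.2 ⟨q - (p + 1), by simp [hlen]; omega, ?_⟩
      have : p.val + 1 + (q - (p + 1)) = q := by omega
      simp [hL, this]
    obtain ⟨S, T, hST⟩ := List.append_of_mem hq
    refine ⟨(L.take p).flatten, S.flatten,
      [true] ++ T.flatten ++ List.replicate (r (Fin.last k)) false, ?_⟩
    rw [binWord, ← hL]
    conv_lhs => rw [hLp, hST]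
    simp

theorem power_count_bound_binary
    (k : ℕ) (hk : 1 ≤ k) (r : Fin (k + 1) → ℕ)
    (hpos : ∃ j, 0 < r j)
    (σ : Equiv.Perm (Fin (k + 1)))
    (hσ : Monotone fun j => r (σ j)) :
    numPowers (binWord k r) + r (σ ⟨k - 1, by omega⟩) ≤ (binWord k r).length - 2 := by
  set s := r (σ ⟨k - 1, by omega⟩) with hs
  have hle : s ≤ r (σ (Fin.last k)) := hσ (Fin.le_last _)
  have hne : σ ⟨k - 1, by omega⟩ ≠ σ (Fin.last k) := fun h => by
    have := congrArg Fin.val (σ.injective h)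
    simp only [Fin.val_last] at this
    omega
  obtain ⟨p, q, hpq, hp, hq⟩ : ∃ p q, p < q ∧ s ≤ r p ∧ s ≤ r q := by
    rcases hne.lt_or_gt with h | h
    · exact ⟨_, _, h, le_rfl, hle⟩
    · exact ⟨_, _, h, hle, le_rfl⟩
  obtain ⟨X, Y, Z, h⟩ := exists_binWord_eq r hpq
  have := numPowers_add_le (s := s) (true_mem_binWord hk r) (false_mem_binWord hpos) fun n hn => by
    obtain ⟨c, hc⟩ := Nat.exists_eq_add_of_le' (hn.trans hp)
    obtain ⟨c', hc'⟩ := Nat.exists_eq_add_of_le (hn.trans hq)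
    refine ⟨X ++ List.replicate c false, Y, List.replicate c' false ++ Z, ?_⟩
    rw [h, hc, hc', List.replicate_add, List.replicate_add]
    simp only [List.append_assoc]
  omega
end

section
/- Let w be a finite word over the alphabet {a,b}, let s(w) denote the number of distinct squares occurring as factors of w, and let k denote the minimum of the number of a's and the number of b's in w. If k ≥ 2, then s(w) ≤ ((2k−1)/(2k+2))·|w|. -/
section

open Finset

/-- The block of length `n` starting at position `i` of the infinite word `f`. -/
def blk {α : Type*} (f : ℕ → α) (i n : ℕ) : List α := (List.range n).map fun t => f (i + t)

@[simp] lemma length_blk {α : Type*} (f : ℕ → α) (i n : ℕ) : (blk f i n).length = n := by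
  simp [blk]

lemma blk_eq_blk_iff {α : Type*} {f g : ℕ → α} {i j n : ℕ} :
    blk f i n = blk g j n ↔ ∀ t < n, f (i + t) = g (j + t) := by
  simp [blk, List.map_inj_left]

lemma blk_add {α : Type*} (f : ℕ → α) (i m n : ℕ) :
    blk f i (m + n) = blk f i m ++ blk f (i + m) n := by
  simp [blk, List.range_add, Function.comp_def, add_assoc]

lemma blk_succ {α : Type*} (f : ℕ → α) (i n : ℕ) :
    blk f i (n + 1) = blk f i n ++ [f (i + n)] := by
  rw [blk_add]; simp [blk]

lemma take_blk_succ {α : Type*} (f : ℕ → α) (i n : ℕ) :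
    (blk f i (n + 1)).take n = blk f i n := by
  rw [blk_succ, List.take_append_of_le_length (by simp), List.take_of_length_le (by simp)]

lemma tail_blk_succ {α : Type*} (f : ℕ → α) (i n : ℕ) :
    (blk f i (n + 1)).tail = blk f (i + 1) n := by
  rw [add_comm n 1, blk_add]; simp [blk]

lemma blk_eq_replicate_iff {α : Type*} {f : ℕ → α} {i n : ℕ} {a : α} :
    blk f i n = List.replicate n a ↔ ∀ t < n, f (i + t) = a := by
  simp [List.eq_replicate_iff, blk]

/-- The factors of length `n` of the word formed by the first `N` letters of `g`. -/
def factors {α : Type*} [DecidableEq α] (g : ℕ → α) (N n : ℕ) : Finset (List α) :=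
  (range (N + 1 - n)).image fun i => blk g i n

lemma mem_factors {α : Type*} [DecidableEq α] {g : ℕ → α} {N n : ℕ} {v : List α} :
    v ∈ factors g N n ↔ ∃ i, i + n ≤ N ∧ blk g i n = v := by
  simp only [factors, mem_image, mem_range]
  refine exists_congr fun i => and_congr_left fun _ => ?_
  omega

lemma blk_mem_factors_of_le {α : Type*} [DecidableEq α] {g f : ℕ → α} {N n i j m : ℕ}
    (h : blk f i n ∈ factors g N n) (hij : i ≤ j) (hjm : j + m ≤ i + n) :
    blk f j m ∈ factors g N m := by
  obtain ⟨p, hp, h⟩ := mem_factors.1 h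
  rw [blk_eq_blk_iff] at h
  refine mem_factors.2 ⟨p + (j - i), by omega, blk_eq_blk_iff.2 fun t ht => ?_⟩
  have := h (j - i + t) (by omega)
  rwa [← add_assoc, ← add_assoc, Nat.add_sub_cancel' hij] at this

/-- Counting edges of a connected graph: if only the constant potentials are invariant
along all edges, there are at most `#E + 1` vertices. -/
lemma card_le_card_add_one_of_potential {β γ : Type*} (V : Finset β) (E : Finset γ)
    (src tgt : γ → β)
    (h : ∀ φ : β → ℚ, (∀ e ∈ E, φ (src e) = φ (tgt e)) → ∀ x ∈ V, ∀ y ∈ V, φ x = φ y) :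
    #V ≤ #E + 1 := by
  classical
  rcases V.eq_empty_or_nonempty with rfl | ⟨v, hv⟩
  · simp
  let ext : (V → ℚ) → β → ℚ := fun φ x => if hx : x ∈ V then φ ⟨x, hx⟩ else 0
  let T : (V → ℚ) →ₗ[ℚ] (Option E → ℚ) :=
    { toFun := fun φ o => o.elim (ext φ v) fun e => ext φ (src e) - ext φ (tgt e)
      map_add' := by
        intro φ ψ
        have hadd : ∀ x, ext (φ + ψ) x = ext φ x + ext ψ x := by
          intro x; simp only [ext]; split_ifs <;> simp
        funext o
        cases o <;> simp [hadd]; ring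
      map_smul' := by
        intro c φ
        have hsmul : ∀ x, ext (c • φ) x = c * ext φ x := by
          intro x; simp only [ext]; split_ifs <;> simp
        funext o
        cases o <;> simp [hsmul]; ring }
  have hT : Function.Injective T := by
    rw [injective_iff_map_eq_zero]
    intro φ hφ
    have h0 : ext φ v = 0 := congrFun hφ none
    have he : ∀ e ∈ E, ext φ (src e) = ext φ (tgt e) := fun e he =>
      sub_eq_zero.1 (congrFun hφ (some ⟨e, he⟩))
    funext x
    have := h (ext φ) he x x.2 v hv
    rw [h0] at this
    simpa [ext] using this
  simpa using LinearMap.finrank_le_finrank_of_injective hT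

/-- `f` is a periodic word with least period `ℓ` whose prefix of length `ℓ` is a Lyndon word. -/
structure IsLyndon {α : Type*} [LinearOrder α] (f : ℕ → α) (ℓ : ℕ) : Prop where
  pos : 0 < ℓ
  periodic : Function.Periodic f ℓ
  not_periodic : ∀ d, 0 < d → d < ℓ → ¬ Function.Periodic f d
  le : ∀ i, blk f 0 ℓ ≤ blk f i ℓ

lemma periodic_mod {α : Type*} {f : ℕ → α} {p q : ℕ} (hp : Function.Periodic f p)
    (hq : Function.Periodic f q) : Function.Periodic f (q % p) := fun x => by
  have h : f (x + q % p + q / p * p) = f (x + q % p) := hp.nat_mul (q / p) _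
  rw [← h, add_assoc, mul_comm, Nat.mod_add_div, hq]

lemma periodic_of_forall_lt {α : Type*} {f : ℕ → α} {p d : ℕ} (hp : Function.Periodic f p)
    (hpos : 0 < p) (h : ∀ t < p, f (t + d) = f t) : Function.Periodic f d := fun x => by
  rw [← hp.map_mod_nat x, ← h _ (Nat.mod_lt x hpos), ← hp.map_mod_nat (x + d),
    ← hp.map_mod_nat (x % p + d), Nat.mod_add_mod]

lemma List.le_of_append_le_append_right {α : Type*} [LinearOrder α] {x u v : List α}
    (h : x ++ v ≤ x ++ u) : v ≤ u := by
  by_contra hc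
  exact absurd h (not_le.2 (List.append_left_lt (not_le.1 hc)))

lemma List.append_right_lt_of_length {α : Type*} [LinearOrder α] {x u v : List α}
    (hl : u.length = v.length) (h : u < v) : u ++ x < v ++ x := by
  induction u generalizing v with
  | nil => simp_all [eq_comm]
  | cons c u ih =>
    cases v with
    | nil => simp at hl
    | cons d v =>
      rw [List.cons_append, List.cons_append, List.cons_lt_cons_iff]
      exact (List.cons_lt_cons_iff.1 h).imp_right fun h => ⟨h.1, ih (by simpa using hl) h.2⟩

lemma List.le_of_append_le_append_of_length {α : Type*} [LinearOrder α] {x u v : List α}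
    (hl : u.length = v.length) (h : u ++ x ≤ v ++ x) : u ≤ v := by
  by_contra hc
  exact absurd h (not_le.2 (List.append_right_lt_of_length hl.symm (not_le.1 hc)))

/-- Lyndon words are unbordered. -/
lemma IsLyndon.exists_ne {α : Type*} [LinearOrder α] {f : ℕ → α} {ℓ d : ℕ} (h : IsLyndon f ℓ)
    (hd : 0 < d) (hdl : d < ℓ) : ∃ x, x + d < ℓ ∧ f (x + d) ≠ f x := by
  by_contra! hc
  obtain ⟨m, rfl⟩ := Nat.exists_eq_add_of_lt hdl
  have hb : blk f d (m + 1) = blk f 0 (m + 1) :=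
    blk_eq_blk_iff.2 fun t ht => by rw [zero_add, add_comm d, hc t (by omega)]
  have hper : ∀ i n, blk f (i + (d + m + 1)) n = blk f i n := fun i n =>
    blk_eq_blk_iff.2 fun t _ => by rw [add_right_comm, h.periodic]
  have h1 := h.le d
  have h2 := h.le (m + 1)
  have e1 : blk f 0 (d + m + 1) = blk f 0 (m + 1) ++ blk f (m + 1) d := by
    rw [show d + m + 1 = (m + 1) + d by omega, blk_add, zero_add]
  have e2 : blk f 0 (d + m + 1) = blk f 0 d ++ blk f 0 (m + 1) := by
    rw [add_assoc, blk_add, zero_add, hb]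
  have e3 : blk f d (d + m + 1) = blk f 0 (m + 1) ++ blk f 0 d := by
    rw [show d + m + 1 = (m + 1) + d by omega, blk_add, hb,
      show d + (m + 1) = 0 + (d + m + 1) by omega, hper]
  have e4 : blk f (m + 1) (d + m + 1) = blk f (m + 1) d ++ blk f 0 (m + 1) := by
    rw [add_assoc, blk_add, show m + 1 + d = 0 + (d + m + 1) by omega, hper]
  rw [e1, e3] at h1
  rw [e2, e4] at h2
  have h3 := le_antisymm (List.le_of_append_le_append_right h1)
    (List.le_of_append_le_append_of_length (by simp) h2)
  have h4 : blk f (m + 1) (d + m + 1) = blk f 0 (d + m + 1) := by rw [e4, e2, h3]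
  refine h.not_periodic (m + 1) (by omega) (by omega)
    (periodic_of_forall_lt h.periodic h.pos fun t ht => ?_)
  have := blk_eq_blk_iff.1 h4 t ht
  rwa [zero_add, add_comm] at this

/-- Every periodic word is a shift of a Lyndon one. -/
lemma exists_isLyndon {α : Type*} [LinearOrder α] {h : ℕ → α} {p : ℕ} (hp : 0 < p)
    (hper : Function.Periodic h p) :
    ∃ f ℓ s, IsLyndon f ℓ ∧ ℓ ∣ p ∧ s < ℓ ∧ ∀ x, h x = f (x + s) := by
  classical
  have hex : ∃ d, 0 < d ∧ Function.Periodic h d := ⟨p, hp, hper⟩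
  obtain ⟨hpos, hℓ⟩ := Nat.find_spec hex
  have hmin : ∀ d, 0 < d → d < Nat.find hex → ¬ Function.Periodic h d := fun d hd hdl hc =>
    Nat.find_min hex hdl ⟨hd, hc⟩
  set ℓ := Nat.find hex
  obtain ⟨i, hi, hile⟩ := exists_min_image (range ℓ) (fun i => blk h i ℓ) ⟨0, by simpa using hpos⟩
  rw [mem_range] at hi
  have hshift : ∀ x, h x = h (i + (x + (ℓ - i) % ℓ)) := fun x => by
    rw [← hℓ.map_mod_nat (i + _), ← hℓ.map_mod_nat x]
    congr 1
    rw [← add_assoc, Nat.add_mod_mod, show i + x + (ℓ - i) = x + ℓ by omega, Nat.add_mod_right]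
  refine ⟨fun x => h (i + x), ℓ, (ℓ - i) % ℓ, ⟨hpos, fun x => ?_, fun d hd hdl hc => ?_, fun j => ?_⟩,
    ?_, Nat.mod_lt _ hpos, hshift⟩
  · exact (congrArg h (add_assoc _ _ _)).symm.trans (hℓ _)
  · refine hmin d hd hdl fun x => ?_
    rw [hshift x, hshift (x + d), add_right_comm]
    exact hc _
  · have := hile ((i + j) % ℓ) (mem_range.2 (Nat.mod_lt _ hpos))
    refine (Eq.trans_le ?_ this).trans_eq ?_
    · exact blk_eq_blk_iff.2 fun t _ => by rw [zero_add]
    · refine blk_eq_blk_iff.2 fun t _ => ?_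
      rw [← hℓ.map_mod_nat ((i + j) % ℓ + t), Nat.mod_add_mod, add_assoc, hℓ.map_mod_nat]
  · by_contra hnd
    have h0 : 0 < p % ℓ := Nat.pos_of_ne_zero fun h0 => hnd (Nat.dvd_of_mod_eq_zero h0)
    exact hmin _ h0 (Nat.mod_lt _ hpos) (periodic_mod hℓ hper)

/-- Two Lyndon words sharing a long enough factor, at the start of the second one. -/
lemma IsLyndon.le_of_blk_eq {α : Type*} [LinearOrder α] {f f' : ℕ → α} {ℓ ℓ' n i : ℕ}
    (h : IsLyndon f ℓ) (h' : IsLyndon f' ℓ') (hn' : ℓ' ≤ n)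
    (he : blk f i (n + 1) = blk f' 0 (n + 1)) : ℓ' ≤ ℓ := by
  by_contra! hlt
  obtain ⟨x, hx, hne⟩ := h'.exists_ne h.pos hlt
  have he := blk_eq_blk_iff.1 he
  have h1 := he x (by omega)
  have h2 := he (x + ℓ) (by omega)
  rw [← add_assoc, h.periodic, h1] at h2
  simp only [zero_add] at h2
  exact hne h2.symm

lemma IsLyndon.dvd_of_blk_eq {α : Type*} [LinearOrder α] {f f' : ℕ → α} {ℓ n i : ℕ}
    (h : IsLyndon f ℓ) (h' : IsLyndon f' ℓ) (hn : ℓ ≤ n)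
    (he : blk f i (n + 1) = blk f' 0 (n + 1)) : ℓ ∣ i := by
  have he := blk_eq_blk_iff.1 he
  have hs : ∀ t, f (i + t) = f' t := fun t => by
    have := he (t % ℓ) ((Nat.mod_lt _ h.pos).trans (by omega))
    rw [zero_add, h'.periodic.map_mod_nat, ← h.periodic.map_mod_nat, Nat.add_mod_mod,
      h.periodic.map_mod_nat] at this
    exact this
  have h1 : blk f i ℓ = blk f' 0 ℓ := blk_eq_blk_iff.2 fun t _ => by rw [hs, zero_add]
  have h2 : blk f 0 ℓ = blk f' (ℓ - i % ℓ) ℓ := blk_eq_blk_iff.2 fun t _ => by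
    have hlt := Nat.mod_lt i h.pos
    have hz : (i + (ℓ - i % ℓ)) % ℓ = 0 := by
      rw [← Nat.mod_add_mod, Nat.add_sub_cancel' hlt.le, Nat.mod_self]
    rw [← hs, zero_add, ← add_assoc, ← h.periodic.map_mod_nat (_ + t), ← Nat.mod_add_mod, hz,
      zero_add, h.periodic.map_mod_nat]
  have h3 : blk f i ℓ = blk f 0 ℓ := le_antisymm (h1.trans_le ((h'.le _).trans_eq h2.symm)) (h.le i)
  by_contra hnd
  have h0 : 0 < i % ℓ := Nat.pos_of_ne_zero fun h0 => hnd (Nat.dvd_of_mod_eq_zero h0)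
  refine h.not_periodic _ h0 (Nat.mod_lt _ h.pos)
    (periodic_of_forall_lt h.periodic h.pos fun t ht => ?_)
  have := blk_eq_blk_iff.1 h3 t ht
  rw [zero_add] at this
  rw [← this, ← h.periodic.map_mod_nat, Nat.add_mod_mod, h.periodic.map_mod_nat, add_comm]

lemma IsLyndon.eq_of_blk_eq {α : Type*} [LinearOrder α] {f f' : ℕ → α} {ℓ ℓ' n n' : ℕ}
    (h : IsLyndon f ℓ) (h' : IsLyndon f' ℓ') (hn : ℓ ≤ n) (hn' : ℓ' ≤ n')
    (he : blk f 0 (n + 1) = blk f' 0 (n' + 1)) : n = n' ∧ ℓ = ℓ' ∧ f = f' := by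
  obtain rfl : n = n' := by simpa using congrArg List.length he
  obtain rfl := le_antisymm (h'.le_of_blk_eq h hn he.symm) (h.le_of_blk_eq h' hn' he)
  refine ⟨rfl, rfl, funext fun t => ?_⟩
  have := blk_eq_blk_iff.1 he (t % ℓ) ((Nat.mod_lt _ h.pos).trans (by omega))
  rwa [zero_add, h'.periodic.map_mod_nat, h.periodic.map_mod_nat] at this

/-- The Lyndon word `f` spells a circuit of length `ℓ ≤ n` in the Rauzy graph of order `n`. -/
structure IsSmallCircuit {α : Type*} [LinearOrder α] (g : ℕ → α) (N n : ℕ) (f : ℕ → α) (ℓ : ℕ) :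
    Prop where
  isLyndon : IsLyndon f ℓ
  le : ℓ ≤ n
  mem : ∀ i, blk f i (n + 1) ∈ factors g N (n + 1)

open Classical in
/-- Edges of the Rauzy graph of order `n` whose removal keeps the graph connected: one for every
small circuit, and the edge `a^n b` if it lies on a circuit. -/
noncomputable def removable {α : Type*} [LinearOrder α] (g : ℕ → α) (N : ℕ) (a b : α) (m n : ℕ) :
    Finset (List α) :=
  {e ∈ factors g N (n + 1) | (∃ f ℓ, IsSmallCircuit g N n f ℓ ∧ e = blk f 0 (n + 1)) ∨
    (n ≤ m ∧ e = List.replicate n a ++ [b])}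

lemma mem_removable {α : Type*} [LinearOrder α] {g : ℕ → α} {N m n : ℕ} {a b : α} {e : List α} :
    e ∈ removable g N a b m n ↔ e ∈ factors g N (n + 1) ∧
      ((∃ f ℓ, IsSmallCircuit g N n f ℓ ∧ e = blk f 0 (n + 1)) ∨
        (n ≤ m ∧ e = List.replicate n a ++ [b])) := by
  simp only [removable, mem_filter]

lemma potential_const {α β : Type*} [DecidableEq α] {g : ℕ → α} {N n : ℕ} {φ : List α → β}
    (h : ∀ i, i + (n + 1) ≤ N → φ (blk g i n) = φ (blk g (i + 1) n)) :
    ∀ x ∈ factors g N n, ∀ y ∈ factors g N n, φ x = φ y := by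
  have key : ∀ i, i + n ≤ N → φ (blk g i n) = φ (blk g 0 n) := by
    intro i
    induction i with
    | zero => simp
    | succ i ih => intro hi; rw [← h i (by omega), ih (by omega)]
  intro x hx y hy
  obtain ⟨i, hi, rfl⟩ := mem_factors.1 hx
  obtain ⟨j, hj, rfl⟩ := mem_factors.1 hy
  rw [key i hi, key j hj]

lemma IsLyndon.blk_ne {α : Type*} [LinearOrder α] {f : ℕ → α} {n ℓ : ℕ} {a b : α}
    (h : IsLyndon f ℓ) (hn : ℓ ≤ n) (hab : a ≠ b) (i : ℕ) :
    blk f i (n + 1) ≠ List.replicate n a ++ [b] := by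
  intro he
  rw [blk_succ] at he
  obtain ⟨h1, h2⟩ := List.append_inj he (by simp)
  have h1 := blk_eq_replicate_iff.1 h1
  have hpos := h.pos
  have h3 := h1 (n - ℓ) (by omega)
  have h4 := h.periodic (i + (n - ℓ))
  rw [add_assoc, Nat.sub_add_cancel hn, h3] at h4
  simp only [List.cons.injEq, and_true] at h2
  exact hab (h4.symm.trans h2)

/-- A potential invariant along non-removable edges is invariant along small circuits. -/
lemma IsSmallCircuit.potential_eq {α : Type*} [LinearOrder α] {g : ℕ → α} {N n m : ℕ} {a b : α}
    (hab : a ≠ b) {φ : List α → ℚ}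
    (hφ : ∀ e ∈ factors g N (n + 1) \ removable g N a b m n, φ (e.take n) = φ e.tail)
    {f : ℕ → α} {ℓ : ℕ} (h : IsSmallCircuit g N n f ℓ) :
    φ (blk f 0 n) = φ (blk f 1 n) := by
  induction ℓ using Nat.strong_induction_on generalizing f with
  | _ ℓ ih =>
  have step : ∀ i, 0 < i → i < ℓ → φ (blk f i n) = φ (blk f (i + 1) n) := by
    intro i hi hil
    by_cases hR : blk f i (n + 1) ∈ removable g N a b m n
    · obtain ⟨-, ⟨f', ℓ', h', he⟩ | ⟨-, he⟩⟩ := mem_removable.1 hR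
      · rcases (h.isLyndon.le_of_blk_eq h'.isLyndon h'.le he).lt_or_eq with hlt | rfl
        · have := ih ℓ' hlt h'
          rw [← take_blk_succ f i, ← tail_blk_succ f i, he, take_blk_succ, tail_blk_succ]
          exact this
        · exact absurd (Nat.le_of_dvd hi (h.isLyndon.dvd_of_blk_eq h'.isLyndon h.le he))
            (not_le.2 hil)
      · exact absurd he (h.isLyndon.blk_ne h.le hab i)
    · have := hφ _ (mem_sdiff.2 ⟨h.mem i, hR⟩)
      rwa [take_blk_succ, tail_blk_succ] at this
  have walk : ∀ i, 0 < i → i ≤ ℓ → φ (blk f 1 n) = φ (blk f i n) := by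
    intro i hi
    induction i, hi using Nat.le_induction with
    | base => intro _; rfl
    | succ i hi ih => intro hil; rw [ih (by omega), step i hi (by omega)]
  rw [walk ℓ h.isLyndon.pos le_rfl]
  congr 1
  exact blk_eq_blk_iff.2 fun t _ => by rw [zero_add, add_comm ℓ, h.isLyndon.periodic]

lemma card_factors_add_card_removable_le {α : Type*} [LinearOrder α] {g : ℕ → α} {N n m : ℕ}
    {a b : α} (hab : a ≠ b)
    (hm : n ≤ m → ∃ i j, i < j ∧ j + n ≤ N ∧ blk g i (n + 1) = List.replicate n a ++ [b] ∧
      blk g j n = List.replicate n a) :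
    #(factors g N n) + #(removable g N a b m n) ≤ #(factors g N (n + 1)) + 1 := by
  have hsub : removable g N a b m n ⊆ factors g N (n + 1) := fun e he => (mem_removable.1 he).1
  suffices h : #(factors g N n) ≤ #(factors g N (n + 1) \ removable g N a b m n) + 1 by
    have := card_sdiff_add_card_eq_card hsub
    omega
  refine card_le_card_add_one_of_potential _ _ (fun e => e.take n) (fun e => e.tail)
    fun φ hφ => potential_const ?_
  have step : ∀ t, t + (n + 1) ≤ N → blk g t n ≠ List.replicate n a →
      φ (blk g t n) = φ (blk g (t + 1) n) := by
    intro t ht hne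
    have hmem : blk g t (n + 1) ∈ factors g N (n + 1) := mem_factors.2 ⟨t, ht, rfl⟩
    by_cases hR : blk g t (n + 1) ∈ removable g N a b m n
    · obtain ⟨-, ⟨f', ℓ', h', he⟩ | ⟨-, he⟩⟩ := mem_removable.1 hR
      · have := h'.potential_eq hab hφ
        rw [← take_blk_succ g t, ← tail_blk_succ g t, he, take_blk_succ, tail_blk_succ]
        exact this
      · rw [blk_succ] at he
        exact absurd (List.append_inj he (by simp)).1 hne
    · have := hφ _ (mem_sdiff.2 ⟨hmem, hR⟩)
      rwa [take_blk_succ, tail_blk_succ] at this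
  intro t ht
  have hmem : blk g t (n + 1) ∈ factors g N (n + 1) := mem_factors.2 ⟨t, ht, rfl⟩
  by_cases hR : blk g t (n + 1) ∈ removable g N a b m n
  · obtain ⟨-, ⟨f', ℓ', h', he⟩ | ⟨hn, he⟩⟩ := mem_removable.1 hR
    · have := h'.potential_eq hab hφ
      rw [← take_blk_succ g t, ← tail_blk_succ g t, he, take_blk_succ, tail_blk_succ]
      exact this
    · obtain ⟨i, j, hij, hj, hi1, hj1⟩ := hm hn
      have hit := hi1.trans he.symm
      rw [← take_blk_succ g t, ← tail_blk_succ g t, ← hit, take_blk_succ, tail_blk_succ]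
      have hi0 : blk g i n = List.replicate n a := by
        rw [blk_succ] at hi1
        exact (List.append_inj hi1 (by simp)).1
      have walk : ∀ s, i + 1 ≤ s → s ≤ j → φ (blk g s n) = φ (blk g (i + 1) n) ∨
          φ (blk g i n) = φ (blk g (i + 1) n) := by
        intro s hs
        induction s, hs using Nat.le_induction with
        | base => exact fun _ => Or.inl rfl
        | succ s hs ih =>
          intro hsj
          by_cases hsa : blk g s n = List.replicate n a
          · right
            rcases ih (by omega) with h | h
            · rwa [hsa, ← hi0] at h
            · exact h
          · rw [← step s (by omega) hsa]
            exact ih (by omega)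
      rcases walk j hij le_rfl with h | h
      · rwa [hj1, ← hi0] at h
      · exact h
  · have := hφ _ (mem_sdiff.2 ⟨hmem, hR⟩)
    rwa [take_blk_succ, tail_blk_succ] at this

/-- If `r + 1` conjugates of `q ^ (2 * s + 2)` occur, where `q` is the Lyndon word `f 0 ⋯ f (ℓ - 1)`,
then `q` spells a circuit in the Rauzy graph of order `(2 * s + 1) * ℓ + r`. -/
lemma IsLyndon.isSmallCircuit_of_lt_count {α : Type*} [LinearOrder α] {g f : ℕ → α} {N ℓ s r : ℕ}
    (h : IsLyndon f ℓ)
    (hr : r < Nat.count (fun i => blk f i ((2 * s + 2) * ℓ) ∈ factors g N ((2 * s + 2) * ℓ)) ℓ) :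
    IsSmallCircuit g N ((2 * s + 1) * ℓ + r) f ℓ := by
  set J := fun i => blk f i ((2 * s + 2) * ℓ) ∈ factors g N ((2 * s + 2) * ℓ) with hJ
  have hJper : Function.Periodic J ℓ := fun i => by
    have : blk f (i + ℓ) ((2 * s + 2) * ℓ) = blk f i ((2 * s + 2) * ℓ) :=
      blk_eq_blk_iff.2 fun t _ => by rw [add_right_comm, h.periodic]
    simp only [hJ, this]
  refine ⟨h, by nlinarith [h.pos], fun j => ?_⟩
  have hcard := Nat.filter_Ico_card_eq_of_periodic (j + 1) ℓ J hJper
  rw [← hcard] at hr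
  obtain ⟨i, hi⟩ : ((Ico (j + 1) (j + 1 + ℓ)).filter J \ Ico (j + 1) (j + 1 + r)).Nonempty := by
    rw [← card_pos]
    have := le_card_sdiff (Ico (j + 1) (j + 1 + r)) ((Ico (j + 1) (j + 1 + ℓ)).filter J)
    rw [Nat.card_Ico] at this
    omega
  simp only [mem_sdiff, mem_filter, mem_Ico] at hi
  obtain ⟨⟨⟨hi1, hi2⟩, hi3⟩, hi4⟩ := hi
  have hmem : blk f (j + ℓ) ((2 * s + 1) * ℓ + r + 1) ∈ factors g N ((2 * s + 1) * ℓ + r + 1) := by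
    refine blk_mem_factors_of_le hi3 (by omega) ?_
    have : (2 * s + 2) * ℓ = (2 * s + 1) * ℓ + ℓ := by ring
    omega
  convert hmem using 1
  exact blk_eq_blk_iff.2 fun t _ => by rw [add_right_comm, h.periodic]

lemma exists_isLyndon_of_square {α : Type*} [LinearOrder α] {u v : List α} (hu : u ≠ [])
    (hv : v = u ++ u) :
    ∃ f ℓ s i, IsLyndon f ℓ ∧ i < ℓ ∧ v = blk f i ((2 * s + 2) * ℓ) := by
  have hL : 0 < u.length := List.length_pos_of_ne_nil hu
  have hlt : ∀ x, x % u.length < u.length := fun x => Nat.mod_lt _ hL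
  obtain ⟨f, ℓ, i, hf, ⟨c, hc⟩, hi, hs⟩ := exists_isLyndon (h := fun x => u[x % u.length]'(hlt x)) hL
    fun x => by simp
  have hc0 : c ≠ 0 := by rintro rfl; omega
  obtain ⟨s, rfl⟩ := Nat.exists_eq_succ_of_ne_zero hc0
  refine ⟨f, ℓ, s, i, hf, hi, ?_⟩
  have hlen : (2 * s + 2) * ℓ = u.length + u.length := by rw [hc, Nat.succ_eq_add_one]; ring
  rw [hlen, hv]
  refine List.ext_getElem (by simp) fun x h1 h2 => ?_
  simp only [blk, List.getElem_map, List.getElem_range]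
  rw [add_comm i, ← hs]
  rw [List.getElem_append]
  split_ifs with hx
  · simp [Nat.mod_eq_of_lt hx]
  · simp only [List.length_append] at h1
    congr 1
    rw [Nat.mod_eq_sub_mod (by omega), Nat.mod_eq_of_lt (by omega)]

lemma card_removable_sum_le {α : Type*} [LinearOrder α] {g : ℕ → α} {N m : ℕ}
    {a b : α} (hab : a ≠ b)
    (hm : ∀ n ≤ m, ∃ i j, i < j ∧ j + n ≤ N ∧ blk g i (n + 1) = List.replicate n a ++ [b] ∧
      blk g j n = List.replicate n a) (hN : 1 ≤ N) :
    #(factors g N 1) + ∑ n ∈ Ico 1 N, #(removable g N a b m n) ≤ N := by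
  have key : ∀ k, 1 ≤ k →
      #(factors g N 1) + ∑ n ∈ Ico 1 k, #(removable g N a b m n) ≤ #(factors g N k) + (k - 1) := by
    intro k hk
    induction k, hk using Nat.le_induction with
    | base => simp
    | succ k hk ih =>
      have := card_factors_add_card_removable_le (g := g) (N := N) hab (hm k)
      rw [sum_Ico_succ_top hk]
      omega
  have h1 := key N hN
  have h2 : #(factors g N N) = 1 := by simp [factors]
  omega

/-- A family of removable edges not accounting for squares improves the bound on the number of
squares. -/
lemma numSquares_add_card_le {α : Type*} [LinearOrder α] {g : ℕ → α} {N m : ℕ}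
    {a b : α} (hab : a ≠ b)
    (hm : ∀ n ≤ m, ∃ i j, i < j ∧ j + n ≤ N ∧ blk g i (n + 1) = List.replicate n a ++ [b] ∧
      blk g j n = List.replicate n a) (hN : 1 ≤ N) (X : Finset (List α))
    (hX : ∀ e ∈ X, ∃ n, 1 ≤ n ∧ e ∈ removable g N a b m n ∧
      ∀ f ℓ, IsLyndon f ℓ → ℓ ≤ n → e = blk f 0 (n + 1) → Even (n / ℓ)) :
    #(factors g N 1) + numSquares (blk g 0 N) + #X ≤ N := by
  classical
  refine le_trans ?_ (card_removable_sum_le hab hm hN)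
  rw [add_assoc, add_le_add_iff_left]
  set S := {v : List α | v <:+: blk g 0 N ∧ ∃ u : List α, u ≠ [] ∧ v = u ++ u}
  have hS : ∀ v ∈ S, v ∈ factors g N v.length := by
    rintro v ⟨⟨x, y, hxy⟩, -⟩
    have hlen := congrArg List.length hxy
    simp only [List.length_append, length_blk] at hlen
    refine mem_factors.2 ⟨x.length, by omega, ?_⟩
    rw [← hlen, blk_add, blk_add, zero_add] at hxy
    exact ((List.append_inj (List.append_inj hxy (by simp)).1 (by simp)).2).symm
  have hfin : S.Finite := by
    refine ((range (N + 1)).biUnion fun n => factors g N n).finite_toSet.subset fun v hv => ?_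
    obtain ⟨i, hi, -⟩ := mem_factors.1 (hS v hv)
    simp only [coe_biUnion, Set.mem_iUnion]
    exact ⟨v.length, by simp; omega, hS v hv⟩
  have hex : ∀ v : S, ∃ f ℓ s i, IsLyndon f ℓ ∧ i < ℓ ∧ (v : List α) = blk f i ((2 * s + 2) * ℓ) := by
    rintro ⟨v, -, u, hu, hv⟩
    exact exists_isLyndon_of_square hu hv
  choose f ℓ s i hf hi hv using hex
  let J : S → ℕ → Prop := fun v i =>
    blk (f v) i ((2 * s v + 2) * ℓ v) ∈ factors g N ((2 * s v + 2) * ℓ v)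
  have hJ : ∀ v, J v (i v) := fun v => by
    have := hS v v.2
    rw [hv v, length_blk] at this
    exact this
  let r : S → ℕ := fun v => Nat.count (J v) (i v)
  have hr : ∀ v, r v < Nat.count (J v) (ℓ v) := fun v => Nat.count_strict_mono (hJ v) (hi v)
  have hrl : ∀ v, r v < ℓ v := fun v => (hr v).trans_le (Nat.count_le _)
  have hcirc : ∀ v, IsSmallCircuit g N ((2 * s v + 1) * ℓ v + r v) (f v) (ℓ v) := fun v =>
    (hf v).isSmallCircuit_of_lt_count (hr v)
  let F : S → List α := fun v => blk (f v) 0 ((2 * s v + 1) * ℓ v + r v + 1)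
  have hdiv : ∀ v, ((2 * s v + 1) * ℓ v + r v) / ℓ v = 2 * s v + 1 := fun v => by
    rw [add_comm, Nat.add_mul_div_right _ _ (hf v).pos, Nat.div_eq_of_lt (hrl v), zero_add]
  have hF : Function.Injective F := by
    intro v v' hvv
    obtain ⟨h1, h2, h3⟩ := (hf v).eq_of_blk_eq (hf v') (hcirc v).le (hcirc v').le hvv
    have h4 : s v = s v' := by
      have h5 := hdiv v
      rw [h1, h2, hdiv v'] at h5
      omega
    have h6 : r v = r v' := by
      rw [h2, h4] at h1
      omega
    have h7 : i v = i v' := by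
      have hJe : J v = J v' := by simp only [J, h2, h3, h4]
      have h8 : r v = Nat.count (J v') (i v) := by simp only [r, hJe]
      rw [h8] at h6
      exact Nat.count_injective (hJe ▸ hJ v) (hJ v') h6
    exact Subtype.ext (by rw [hv v, hv v', h2, h3, h4, h7])
  have hpos : ∀ v, 1 ≤ (2 * s v + 1) * ℓ v + r v := fun v => by nlinarith [(hf v).pos]
  have := hfin.fintype
  have hdisj : Disjoint (univ.image F) X := by
    rw [disjoint_left]
    intro e he heX
    obtain ⟨v, -, rfl⟩ := mem_image.1 he
    obtain ⟨n, -, hn, hev⟩ := hX _ heX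
    obtain ⟨p, -, hp⟩ := mem_factors.1 (mem_removable.1 hn).1
    have hlen : n = (2 * s v + 1) * ℓ v + r v := by simpa [F] using congrArg List.length hp
    have := hev (f v) (ℓ v) (hf v) (hlen ▸ (hcirc v).le) (by rw [hlen])
    rw [hlen, hdiv v] at this
    exact absurd this (by simp)
  have hcard : numSquares (blk g 0 N) = #(univ.image F) := by
    rw [card_image_of_injective _ hF, card_univ, ← Nat.card_eq_fintype_card]
    exact (Nat.card_coe_set_eq S).symm
  rw [hcard, ← card_union_of_disjoint hdisj]
  have hlt : ∀ {n e}, e ∈ removable g N a b m n → n < N := by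
    intro n e he
    obtain ⟨p, hp, -⟩ := mem_factors.1 (mem_removable.1 he).1
    omega
  refine (card_le_card ?_).trans card_biUnion_le
  intro e he
  rw [mem_biUnion]
  rcases mem_union.1 he with he | he
  · obtain ⟨v, -, rfl⟩ := mem_image.1 he
    have hmem : F v ∈ removable g N a b m ((2 * s v + 1) * ℓ v + r v) :=
      mem_removable.2 ⟨(hcirc v).mem 0, Or.inl ⟨_, _, hcirc v, rfl⟩⟩
    exact ⟨_, mem_Ico.2 ⟨hpos v, hlt hmem⟩, hmem⟩
  · obtain ⟨n, hn, hmem, -⟩ := hX e he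
    exact ⟨n, mem_Ico.2 ⟨hn, hlt hmem⟩, hmem⟩

lemma isLyndon_const {α : Type*} [LinearOrder α] (a : α) : IsLyndon (fun _ => a) 1 where
  pos := one_pos
  periodic _ := rfl
  not_periodic d h1 h2 := by omega
  le i := le_of_eq (blk_eq_blk_iff.2 fun _ _ => rfl)

/-- A factor conjugate to `(a ^ M * b) ^ 3` yields a small circuit not accounting for squares. -/
lemma exists_isSmallCircuit_of_cube {α : Type*} [LinearOrder α] {g : ℕ → α} {N M c p : ℕ} {a b : α}
    (hab : a ≠ b) (hc : c ≤ M) (hp : p + 3 * (M + 1) ≤ N)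
    (hg : ∀ x < 3 * (M + 1), g (p + x) = if x % (M + 1) = c then b else a) :
    ∃ f, IsSmallCircuit g N (2 * (M + 1)) f (M + 1) ∧ b ∈ blk f 0 (M + 1) := by
  obtain ⟨f, ℓ, s, hf, hℓ, hs, hfs⟩ := exists_isLyndon (p := M + 1)
    (h := fun x => if x % (M + 1) = c then b else a) (by omega) fun x => by simp
  obtain rfl : ℓ = M + 1 := by
    have hle := Nat.le_of_dvd (by omega) hℓ
    have hcmod : c % (M + 1) = c := Nat.mod_eq_of_lt (by omega)
    have h1 := hfs c
    have h2 := hfs (c + ℓ)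
    rw [add_right_comm, hf.periodic, ← h1, if_pos hcmod] at h2
    have h3 : (c + ℓ) % (M + 1) = c := by
      by_contra h3
      rw [if_neg h3] at h2
      exact hab h2
    by_contra hne
    have hpos := hf.pos
    rcases lt_or_ge (c + ℓ) (M + 1) with h4 | h4
    · rw [Nat.mod_eq_of_lt h4] at h3; omega
    · rw [Nat.mod_eq_sub_mod h4, Nat.mod_eq_of_lt (by omega)] at h3; omega
  have hmem : blk f s (3 * (M + 1)) ∈ factors g N (3 * (M + 1)) :=
    mem_factors.2 ⟨p, hp, blk_eq_blk_iff.2 fun t ht => by rw [hg t ht, add_comm s, ← hfs]⟩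
  refine ⟨f, ⟨hf, by omega, fun i => ?_⟩, ?_⟩
  · have hlt := Nat.mod_lt i hf.pos
    rcases le_or_gt s (i % (M + 1)) with h | h
    · convert blk_mem_factors_of_le (j := i % (M + 1)) (m := 2 * (M + 1) + 1) hmem h (by omega) using 1
      exact blk_eq_blk_iff.2 fun t _ => by
        rw [← hf.periodic.map_mod_nat, ← Nat.mod_add_mod, hf.periodic.map_mod_nat]
    · convert blk_mem_factors_of_le (j := i % (M + 1) + (M + 1)) (m := 2 * (M + 1) + 1) hmem
        (by omega) (by omega) using 1
      exact blk_eq_blk_iff.2 fun t _ => by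
        rw [add_right_comm, hf.periodic, ← hf.periodic.map_mod_nat, ← Nat.mod_add_mod,
          hf.periodic.map_mod_nat]
  · have h1 := hfs c
    rw [if_pos (Nat.mod_eq_of_lt (by omega)), ← hf.periodic.map_mod_nat] at h1
    rw [h1]
    exact List.mem_map.2 ⟨_, List.mem_range.2 (Nat.mod_lt _ hf.pos), by rw [zero_add]⟩

/-- The starting position of the `j`-th run of a word whose runs have lengths `r 0, r 1, …` and are
separated by single letters. -/
def runStart (r : ℕ → ℕ) (j : ℕ) : ℕ := ∑ i ∈ range j, (r i + 1)

lemma runStart_succ (r : ℕ → ℕ) (j : ℕ) : runStart r (j + 1) = runStart r j + r j + 1 := by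
  simp only [runStart, sum_range_succ, add_assoc]

lemma runStart_mono (r : ℕ → ℕ) : Monotone (runStart r) :=
  monotone_nat_of_le_succ fun j => by rw [runStart_succ]; omega

/-- The first `N` letters of `g` form the word `a ^ r 0 * b * a ^ r 1 * b * ⋯ * b * a ^ r k`. -/
structure IsRuns {α : Type*} (g : ℕ → α) (N : ℕ) (a b : α) (k : ℕ) (r : ℕ → ℕ) : Prop where
  end_eq : runStart r (k + 1) = N + 1
  eq_left : ∀ j ≤ k, ∀ t < r j, g (runStart r j + t) = a
  eq_right : ∀ j < k, g (runStart r j + r j) = b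

lemma exists_isRuns {α : Type*} [DecidableEq α] {a b : α} (hab : a ≠ b)
    (hα : ∀ x, x = a ∨ x = b) (g : ℕ → α) (N : ℕ) :
    ∃ r : ℕ → ℕ, IsRuns g N a b (Nat.count (g · = b) N) r := by
  induction N with
  | zero => exact ⟨fun _ => 0, by simp [runStart], by simp, by simp⟩
  | succ N ih =>
    obtain ⟨r, h1, h2, h3⟩ := ih
    set k := Nat.count (g · = b) N with hk
    have hsum : ∀ q v, ∀ j ≤ q,
        runStart (Function.update r q v) j = runStart r j := fun q v j hj =>
      sum_congr rfl fun i hi => by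
        rw [Function.update_of_ne (by have := mem_range.1 hi; omega)]
    rw [runStart_succ] at h1
    rcases hα (g N) with hN | hN
    · have hcount : Nat.count (g · = b) (N + 1) = k := by
        rw [Nat.count_succ, if_neg (by rw [hN]; exact hab), hk, add_zero]
      rw [hcount]
      refine ⟨Function.update r k (r k + 1), ?_, fun j hj t ht => ?_, fun j hj => ?_⟩
      · rw [runStart_succ, hsum _ _ _ le_rfl, Function.update_self]; omega
      · rw [hsum _ _ _ hj]
        rcases hj.lt_or_eq with hj | rfl
        · rw [Function.update_of_ne hj.ne] at ht
          exact h2 j hj.le t ht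
        · rw [Function.update_self] at ht
          rcases (Nat.lt_succ_iff.1 ht).lt_or_eq with ht | rfl
          · exact h2 _ le_rfl t ht
          · rw [show runStart r k + r k = N by omega, hN]
      · rw [hsum _ _ _ hj.le, Function.update_of_ne hj.ne]
        exact h3 j hj
    · have hcount : Nat.count (g · = b) (N + 1) = k + 1 := by
        rw [Nat.count_succ, if_pos hN]
      rw [hcount]
      refine ⟨Function.update r (k + 1) 0, ?_, fun j hj t ht => ?_, fun j hj => ?_⟩
      · rw [runStart_succ, hsum _ _ _ le_rfl, Function.update_self, runStart_succ]; omega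
      · rw [hsum _ _ _ hj]
        rcases hj.lt_or_eq with hj | rfl
        · rw [Function.update_of_ne hj.ne] at ht
          exact h2 j (by omega) t ht
        · simp at ht
      · rw [hsum _ _ _ hj.le, Function.update_of_ne hj.ne]
        rcases (Nat.lt_succ_iff.1 hj).lt_or_eq with hj | rfl
        · exact h3 j hj
        · rw [show runStart r k + r k = N by omega, hN]

namespace IsRuns

variable {α : Type*} {g : ℕ → α} {N k : ℕ} {a b : α} {r : ℕ → ℕ}

lemma runStart_add_le (h : IsRuns g N a b k r) {j : ℕ} (hj : j ≤ k) :
    runStart r j + r j ≤ N := by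
  have := runStart_mono r (Nat.succ_le_succ hj)
  rw [Nat.succ_eq_add_one, runStart_succ, Nat.succ_eq_add_one, h.end_eq] at this
  omega

lemma sum_add_eq (h : IsRuns g N a b k r) : ∑ j ∈ range (k + 1), r j + k = N := by
  have := h.end_eq
  rw [runStart, sum_add_distrib, sum_const, card_range, smul_eq_mul, mul_one] at this
  omega

/-- Between two runs of length at least `n` there is a path from `a ^ n` to itself starting with the
edge `a ^ n * b`. -/
lemma exists_return (h : IsRuns g N a b k r) {j j' n : ℕ} (hjj : j < j') (hj' : j' ≤ k)
    (hn : n ≤ r j) (hn' : n ≤ r j') :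
    ∃ i i', i < i' ∧ i' + n ≤ N ∧ blk g i (n + 1) = List.replicate n a ++ [b] ∧
      blk g i' n = List.replicate n a := by
  have h1 := runStart_mono r (Nat.succ_le_of_lt hjj)
  rw [Nat.succ_eq_add_one, runStart_succ] at h1
  have h2 := h.runStart_add_le hj'
  refine ⟨runStart r j + (r j - n), runStart r j', by omega, by omega, ?_,
    blk_eq_replicate_iff.2 fun t ht => h.eq_left j' hj' t (by omega)⟩
  rw [blk_succ, add_assoc, Nat.sub_add_cancel hn, h.eq_right j (by omega),
    blk_eq_replicate_iff.2 fun t ht => ?_]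
  rw [add_assoc]
  exact h.eq_left j (by omega) _ (by omega)

/-- Three consecutive runs of length `M` and an adjacent `b` form a conjugate of `(a ^ M * b) ^ 3`. -/
lemma exists_cube (h : IsRuns g N a b k r) {M j : ℕ} (hk3 : 3 ≤ k) (hjk : j + 2 ≤ k)
    (hr0 : r j = M) (hr1 : r (j + 1) = M) (hr2 : r (j + 2) = M) :
    ∃ c p, c ≤ M ∧ p + 3 * (M + 1) ≤ N ∧
      ∀ x < 3 * (M + 1), g (p + x) = if x % (M + 1) = c then b else a := by
  have hPsucc := runStart_succ r
  have hA := h.eq_left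
  have hB := h.eq_right
  have hP1 : runStart r (j + 1) = runStart r j + M + 1 := by rw [hPsucc, hr0]
  have hP2 : runStart r (j + 2) = runStart r j + 2 * M + 2 := by rw [hPsucc, hP1, hr1]; ring
  have hP3 : runStart r (j + 3) = runStart r j + 3 * M + 3 := by rw [hPsucc, hP2, hr2]; ring
  have hrun : ∀ t < M, g (runStart r j + t) = a ∧ g (runStart r j + M + 1 + t) = a ∧ g (runStart r j + 2 * M + 2 + t) = a := by
    intro t ht
    rw [← hP2, ← hP1]
    exact ⟨hA _ (by omega) _ (by omega), hA _ (by omega) _ (by omega), hA _ (by omega) _ (by omega)⟩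
  have hb0 : g (runStart r j + M) = b := by rw [← hr0]; exact hB _ (by omega)
  have hb1 : g (runStart r j + 2 * M + 1) = b := by
    have := hB (j + 1) (by omega)
    rwa [hP1, hr1, show runStart r j + M + 1 + M = runStart r j + 2 * M + 1 by ring] at this
  have hdecomp : ∀ x < 3 * (M + 1), x % (M + 1) ≤ M ∧ (x = x % (M + 1) ∨
      x = M + 1 + x % (M + 1) ∨ x = 2 * M + 2 + x % (M + 1)) := by
    intro x hx
    have h1 := Nat.div_add_mod x (M + 1)
    have h2 := Nat.mod_lt x (show 0 < M + 1 by omega)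
    have h3 : x / (M + 1) < 3 := Nat.div_lt_of_lt_mul (by rwa [mul_comm])
    refine ⟨by omega, ?_⟩
    interval_cases x / (M + 1) <;> omega
  rcases le_or_gt (j + 3) k with hj3 | hj3
  · have hb2 : g (runStart r j + 3 * M + 2) = b := by
      have := hB (j + 2) (by omega)
      rwa [hP2, hr2, show runStart r j + 2 * M + 2 + M = runStart r j + 3 * M + 2 by ring] at this
    have hend := h.runStart_add_le hj3
    refine ⟨M, runStart r j, le_rfl, by omega, fun x hx => ?_⟩
    obtain ⟨ht, hxt⟩ := hdecomp x hx
    generalize x % (M + 1) = t at ht hxt ⊢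
    split_ifs with htM
    · subst htM
      rcases hxt with rfl | rfl | rfl
      · exact hb0
      · rw [← hb1]; congr 1; ring
      · rw [← hb2]; congr 1; ring
    · obtain ⟨h0, h1, h2⟩ := hrun t (by omega)
      rcases hxt with rfl | rfl | rfl
      · exact h0
      · rw [← h1]; congr 1; ring
      · rw [← h2]; congr 1; ring
  · obtain ⟨i, rfl⟩ := Nat.exists_eq_add_of_le' (show 1 ≤ j by omega)
    have hend := h.runStart_add_le hjk
    have hbi := hB i (by omega)
    have hPi := hPsucc i
    refine ⟨0, runStart r i + r i, Nat.zero_le _, by omega, fun x hx => ?_⟩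
    obtain ⟨ht, hxt⟩ := hdecomp x hx
    generalize x % (M + 1) = t at ht hxt ⊢
    split_ifs with ht0
    · subst ht0
      rcases hxt with rfl | rfl | rfl
      · exact hbi
      · rw [← hb0]; congr 1; omega
      · rw [← hb1]; congr 1; omega
    · obtain ⟨h0, h1, h2⟩ := hrun (t - 1) (by omega)
      rcases hxt with rfl | rfl | rfl
      · rw [← h0]; congr 1; omega
      · rw [← h1]; congr 1; omega
      · rw [← h2]; congr 1; omega
end IsRuns

/-- If among any three consecutive terms bounded by `M` one is smaller than `M`, then a third of the
terms is lost. -/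
lemma sum_range_add_div_three_le {r : ℕ → ℕ} {M k : ℕ} (hM : ∀ j ≤ k, r j ≤ M)
    (h : ∀ j, j + 2 ≤ k → ¬ (r j = M ∧ r (j + 1) = M ∧ r (j + 2) = M)) :
    ∀ q ≤ k + 1, ∑ j ∈ range q, r j + q / 3 ≤ q * M
  | 0, _ => by simp
  | 1, _ => by simpa using hM 0 (by omega)
  | 2, hq => by
    have := hM 0 (by omega)
    have := hM 1 (by omega)
    simp [sum_range_succ]; omega
  | q + 3, hq => by
    have ih := sum_range_add_div_three_le hM h q (by omega)
    have h0 := hM q (by omega)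
    have h1 := hM (q + 1) (by omega)
    have h2 := hM (q + 2) (by omega)
    have h3 := h q (by omega)
    rw [sum_range_succ, sum_range_succ, sum_range_succ, Nat.add_div_right _ (by omega), add_mul]
    omega

theorem numSquares_bound_of_count {α : Type*} [LinearOrder α] {g : ℕ → α} {N k : ℕ} {a b : α}
    (hab : a ≠ b) (hα : ∀ x, x = a ∨ x = b) (ha : ∃ x < N, g x = a)
    (hk : Nat.count (g · = b) N = k) (hk2 : 2 ≤ k) :
    3 * N + 2 * (k + 1) * numSquares (blk g 0 N) ≤ 2 * (k + 1) * N := by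
  obtain ⟨r, h⟩ := exists_isRuns hab hα g N
  rw [hk] at h
  obtain ⟨j0, hj0, hmax0⟩ := exists_max_image (range (k + 1)) r ⟨0, by simp⟩
  obtain ⟨j1, hj1, hmax1⟩ := exists_max_image ((range (k + 1)).erase j0) r (by
    rw [← card_pos, card_erase_of_mem hj0, card_range]; omega)
  have hmM : r j1 ≤ r j0 := hmax0 _ (mem_of_mem_erase hj1)
  have hj10 : j1 ≠ j0 := ne_of_mem_erase hj1
  have hj1k : j1 ≤ k := by have := mem_range.1 (mem_of_mem_erase hj1); omega
  have hj0k : j0 ≤ k := by have := mem_range.1 hj0; omega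
  set M := r j0
  set m := r j1
  have hm : ∀ n ≤ m, ∃ i j, i < j ∧ j + n ≤ N ∧ blk g i (n + 1) = List.replicate n a ++ [b] ∧
      blk g j n = List.replicate n a := by
    intro n hn
    rcases hj10.lt_or_gt with hlt | hlt
    · exact h.exists_return hlt hj0k hn (hn.trans hmM)
    · exact h.exists_return hlt hj1k (hn.trans hmM) hn
  have hN : 1 ≤ N := by obtain ⟨x, hx, -⟩ := ha; omega
  have hletters : 2 ≤ #(factors g N 1) := by
    rw [← card_pair (show [a] ≠ [b] by simpa using hab)]
    refine card_le_card (insert_subset ?_ (singleton_subset_iff.2 ?_))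
    · obtain ⟨x, hx, hxa⟩ := ha
      exact mem_factors.2 ⟨x, hx, by simp [blk, hxa]⟩
    · have h1 := h.runStart_add_le (show 1 ≤ k by omega)
      rw [runStart_succ] at h1
      exact mem_factors.2 ⟨runStart r 0 + r 0, by omega, by simp [blk, h.eq_right 0 (by omega)]⟩
  let A := (range ((M - 1) / 2)).image fun t => List.replicate (2 * t + 3) a
  let X := (Icc 1 m).image fun n => List.replicate n a ++ [b]
  have hAcard : #A = (M - 1) / 2 := by
    rw [card_image_of_injective _ fun s t h => ?_, card_range]
    simpa using congrArg List.length h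
  have hXcard : #X = m := by
    rw [card_image_of_injective _ fun s t h => ?_, Nat.card_Icc, Nat.add_sub_cancel]
    simpa using congrArg List.length h
  have hAX : Disjoint A X := by
    rw [disjoint_left]
    intro e he he'
    obtain ⟨t, -, rfl⟩ := mem_image.1 he
    obtain ⟨n, -, hn⟩ := mem_image.1 he'
    have : b ∈ List.replicate (2 * t + 3) a := by rw [← hn]; simp
    exact hab (List.eq_of_mem_replicate this).symm
  have hAXrem : ∀ e ∈ A ∪ X, ∃ n, 1 ≤ n ∧ e ∈ removable g N a b m n ∧
      ∀ f ℓ, IsLyndon f ℓ → ℓ ≤ n → e = blk f 0 (n + 1) → Even (n / ℓ) := by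
    intro e he
    rcases mem_union.1 he with he | he
    · obtain ⟨t, ht, rfl⟩ := mem_image.1 he
      rw [mem_range] at ht
      have hconst : ∀ i, blk (fun _ => a) i (2 * t + 2 + 1) = List.replicate (2 * t + 3) a :=
        fun i => blk_eq_replicate_iff.2 fun _ _ => rfl
      have hmem : List.replicate (2 * t + 3) a ∈ factors g N (2 * t + 2 + 1) := by
        have := h.runStart_add_le hj0k
        exact mem_factors.2 ⟨runStart r j0, by omega,
          blk_eq_replicate_iff.2 fun s hs => h.eq_left j0 hj0k s (by omega)⟩
      refine ⟨2 * t + 2, by omega, mem_removable.2 ⟨hmem, Or.inl ⟨_, 1, ⟨isLyndon_const a, by omega,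
        fun i => by rwa [hconst]⟩, (hconst 0).symm⟩⟩, fun f ℓ hf hℓ hfe => ?_⟩
      rw [← hconst 0] at hfe
      obtain ⟨-, rfl, -⟩ := (isLyndon_const a).eq_of_blk_eq hf (by omega) hℓ hfe
      rw [Nat.div_one]
      exact ⟨t + 1, by ring⟩
    · obtain ⟨n, hn, rfl⟩ := mem_image.1 he
      rw [mem_Icc] at hn
      obtain ⟨i, j, hij, hj, hi, -⟩ := hm n hn.2
      exact ⟨n, hn.1, mem_removable.2 ⟨mem_factors.2 ⟨i, by omega, hi⟩, Or.inr ⟨hn.2, rfl⟩⟩,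
        fun f ℓ hf hℓ hfe => absurd hfe.symm (hf.blk_ne hℓ hab 0)⟩
  have hcard : #(A ∪ X) = (M - 1) / 2 + m := by
    rw [card_union_of_disjoint hAX, hAcard, hXcard]
  have hD := numSquares_add_card_le hab hm hN (A ∪ X) hAXrem
  have hr := h.sum_add_eq
  have hrM : ∀ j ≤ k, r j ≤ M := fun j hj => hmax0 j (mem_range.2 (by omega))
  have hlin : 2 * numSquares (blk g 0 N) + 2 * m + M + 2 ≤ 2 * N := by omega
  have hmul := Nat.mul_le_mul_left (k + 1) hlin
  rcases hmM.lt_or_eq with hlt | heq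
  · have hle : ∑ j ∈ range (k + 1), r j ≤ M + k * m := by
      rw [← add_sum_erase _ _ hj0]
      have : ∑ j ∈ (range (k + 1)).erase j0, r j ≤ _ := sum_le_card_nsmul _ _ _ hmax1
      rw [card_erase_of_mem hj0, card_range, smul_eq_mul, Nat.add_sub_cancel] at this
      omega
    obtain ⟨d, hd⟩ := Nat.exists_eq_add_of_lt hlt
    obtain ⟨k', rfl⟩ := Nat.exists_eq_add_of_le hk2
    rw [hd] at hle hmul
    nlinarith [Nat.zero_le (d * k')]
  by_cases htriple : 3 ≤ k ∧ ∃ j, j + 2 ≤ k ∧ r j = M ∧ r (j + 1) = M ∧ r (j + 2) = M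
  · obtain ⟨hk3, j, hjk, hr0, hr1, hr2⟩ := htriple
    obtain ⟨c, p, hc, hp, hg⟩ := h.exists_cube hk3 hjk hr0 hr1 hr2
    obtain ⟨f, hf, hbf⟩ := exists_isSmallCircuit_of_cube hab hc hp hg
    have hnot : blk f 0 (2 * (M + 1) + 1) ∉ A ∪ X := by
      intro he
      rcases mem_union.1 he with he | he
      · obtain ⟨t, -, ht⟩ := mem_image.1 he
        have : b ∈ blk f 0 (2 * (M + 1) + 1) := by
          rw [show 2 * (M + 1) + 1 = M + 1 + (M + 2) by ring, blk_add]
          exact List.mem_append_left _ hbf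
        rw [← ht] at this
        exact hab (List.eq_of_mem_replicate this).symm
      · obtain ⟨n, hn, hne⟩ := mem_image.1 he
        have := congrArg List.length hne
        simp only [List.length_append, List.length_replicate, List.length_singleton,
          length_blk] at this
        rw [mem_Icc] at hn
        omega
    have hD' := numSquares_add_card_le hab hm hN (insert (blk f 0 (2 * (M + 1) + 1)) (A ∪ X))
      fun e he => by
        rcases mem_insert.1 he with rfl | he
        · refine ⟨2 * (M + 1), by omega, mem_removable.2 ⟨hf.mem 0, Or.inl ⟨f, _, hf, rfl⟩⟩,
            fun f' ℓ' hf' hℓ' he' => ?_⟩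
          obtain ⟨-, rfl, -⟩ := hf.isLyndon.eq_of_blk_eq hf' hf.le hℓ' he'
          rw [Nat.mul_div_cancel _ (by omega)]
          exact even_two
        · exact hAXrem e he
    rw [card_insert_of_notMem hnot, hcard] at hD'
    have hlin' : 2 * numSquares (blk g 0 N) + 3 * M + 4 ≤ 2 * N := by omega
    have hmul' := Nat.mul_le_mul_left (k + 1) hlin'
    have hle : ∑ j ∈ range (k + 1), r j ≤ (k + 1) * M := by
      have : ∑ j ∈ range (k + 1), r j ≤ _ := sum_le_card_nsmul _ _ _ hmax0
      rwa [card_range, smul_eq_mul] at this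
    nlinarith
  · rw [heq] at hmul
    have hloss : 3 * (∑ j ∈ range (k + 1), r j + k) ≤ 3 * ((k + 1) * M) + 2 * (k + 1) := by
      rcases hk2.lt_or_eq with hk3 | rfl
      · have := sum_range_add_div_three_le hrM
          (fun j hj hc => htriple ⟨hk3, j, hj, hc⟩) (k + 1) le_rfl
        omega
      · have : ∑ j ∈ range (2 + 1), r j ≤ _ := sum_le_card_nsmul _ _ _ hmax0
        rw [card_range, smul_eq_mul] at this
        omega
    rw [hr] at hloss
    linarith

lemma blk_getD {α : Type*} (w : List α) (d : α) : blk (fun i => w.getD i d) 0 w.length = w := by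
  refine List.ext_getElem (by simp) fun x h1 h2 => ?_
  simp [blk, h2]

lemma count_blk {α : Type*} [DecidableEq α] (g : ℕ → α) (b : α) (N : ℕ) :
    (blk g 0 N).count b = Nat.count (g · = b) N := by
  induction N with
  | zero => simp [blk]
  | succ N ih =>
    rw [blk_succ, List.count_append, ih, Nat.count_succ, zero_add, List.count_singleton]
    simp

lemma three_mul_length_add_le {α : Type*} [LinearOrder α] {w : List α} {a b : α} (hab : a ≠ b)
    (hα : ∀ x, x = a ∨ x = b) (ha : a ∈ w) (hb : 2 ≤ w.count b) :
    3 * w.length + 2 * (w.count b + 1) * numSquares w ≤ 2 * (w.count b + 1) * w.length := by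
  have hw := blk_getD w a
  have hcount := count_blk (fun i => w.getD i a) b w.length
  rw [hw] at hcount
  obtain ⟨x, hx, hxa⟩ := List.getElem_of_mem ha
  have := numSquares_bound_of_count (g := fun i => w.getD i a) hab hα
    ⟨x, hx, by simp [hx, hxa]⟩ hcount.symm hb
  rwa [hw] at this

end

theorem square_count_bound_binary
    (w : List Bool) (k : ℕ)
    (hk : k = min (w.count false) (w.count true)) (hk2 : 2 ≤ k) :
    (numSquares w : ℚ) ≤ (2 * k - 1) / (2 * k + 2) * w.length := by
  have key : 3 * w.length + 2 * (k + 1) * numSquares w ≤ 2 * (k + 1) * w.length := by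
    rcases min_choice (w.count false) (w.count true) with h | h <;> rw [h] at hk
    · rw [hk] at hk2 ⊢
      exact three_mul_length_add_le (a := true) (by decide) (by decide)
        (List.count_pos_iff.1 (by omega)) hk2
    · rw [hk] at hk2 ⊢
      exact three_mul_length_add_le (a := false) (by decide) (by decide)
        (List.count_pos_iff.1 (by omega)) hk2
  have key' : (3 * w.length + 2 * (k + 1) * numSquares w : ℚ) ≤ 2 * (k + 1) * w.length := by
    exact_mod_cast key
  rw [div_mul_eq_mul_div, le_div_iff₀ (by positivity)]
  linarith
end

section
/- For every finite word w and every integer j ≥ 2, let m_j(w) denote the number of distinct nonempty factors of w of the form u^j with u a nonempty word. Then (j−1)·m_j(w) ≤ |w| − |Alph(w)|. -/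
/-- `numPowersExp j w` is the number of distinct nonempty factors of `w`
of the form `u^j` with `u` nonempty. -/
noncomputable def numPowersExp {α : Type*} (j : ℕ) (w : List α) : ℕ :=
  Set.ncard {v : List α | v <:+: w ∧ ∃ u : List α, u ≠ [] ∧ v = (List.replicate j u).flatten}

namespace KPowers

variable {α : Type*}

/-- The factor of length `n` at position `i` of the infinite word `x`. -/
def window (x : ℕ → α) (i n : ℕ) : List α := (List.range' i n).map x

/-- The set of factors of length `n` of `w`. -/
def factors (w : List α) (n : ℕ) : Set (List α) := {v | v <:+: w ∧ v.length = n}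

/-- `x` has period `p` and is lexicographically smaller than its shifts by `0 < i < p`. -/
def IsLyndon [LinearOrder α] (x : ℕ → α) (p : ℕ) : Prop :=
  0 < p ∧ x.Periodic p ∧ ∀ i, 0 < i → i < p → toLex x < toLex fun k => x (i + k)

/-- The small circuits of the Rauzy graph of order `n` of `w`. -/
def circuits [LinearOrder α] (w : List α) (n : ℕ) : Set ((ℕ → α) × ℕ) :=
  {c | IsLyndon c.1 c.2 ∧ c.2 ≤ n ∧ ∀ i, window c.1 i (n + 1) <:+: w}

@[simp] lemma length_window (x : ℕ → α) (i n : ℕ) : (window x i n).length = n := by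
  simp [window]

lemma window_eq_window_iff {x y : ℕ → α} {i k n : ℕ} :
    window x i n = window y k n ↔ ∀ t < n, x (i + t) = y (k + t) := by
  constructor
  · intro h t ht
    have := congrArg (fun l => l[t]?) h
    simpa [window, ht] using this
  · intro h
    apply List.ext_getElem (by simp)
    intro t ht _
    simpa [window] using h t (by simpa using ht)

lemma window_infix (x : ℕ → α) {i n k m : ℕ} (h : k + m ≤ n) :
    window x (i + k) m <:+: window x i n := by
  refine List.IsInfix.map _ ⟨List.range' i k, List.range' (i + k + m) (n - k - m), ?_⟩
  rw [List.range'_append_1, add_assoc, List.range'_append_1]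
  congr 1; omega

lemma window_take (x : ℕ → α) (i n : ℕ) : (window x i (n + 1)).take n = window x i n := by
  simp [window, ← List.map_take, List.take_range'_of_length_ge]

lemma window_tail (x : ℕ → α) (i n : ℕ) : (window x i (n + 1)).tail = window x (i + 1) n := by
  simp [window, List.range'_succ]

lemma window_congr_mod {x : ℕ → α} {p : ℕ} (hx : x.Periodic p) {i k : ℕ} (h : i ≡ k [MOD p])
    (n : ℕ) : window x i n = window x k n := by
  rw [window_eq_window_iff]
  intro t _
  rw [← hx.map_mod_nat (i + t), ← hx.map_mod_nat (k + t), (h.add_right t)]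

lemma finite_factors (w : List α) (n : ℕ) : (factors w n).Finite :=
  (List.finite_toSet w.sublists).subset fun v hv => by
    simpa using hv.1.sublist

lemma toLex_lt_iff [LinearOrder α] {x y : ℕ → α} :
    toLex x < toLex y ↔ ∃ i, (∀ k < i, x k = y k) ∧ x i < y i := Iff.rfl

/-- The root of a Lyndon infinite word is unbordered. -/
lemma IsLyndon.not_border [LinearOrder α] {x : ℕ → α} {p q : ℕ} (h : IsLyndon x p) (hq : 0 < q)
    (hqp : q < p) : ¬ ∀ k, k + q < p → x k = x (q + k) := by
  intro hb
  obtain ⟨-, hper, hlt⟩ := h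
  obtain ⟨d, hd, hdl⟩ := toLex_lt_iff.1 (hlt q hq hqp)
  have hdp : p - q ≤ d := by
    by_contra hc
    exact hdl.ne (hb d (by omega))
  refine lt_asymm (hlt (p - q) (by omega) (by omega)) (toLex_lt_iff.2 ⟨d - (p - q), ?_, ?_⟩)
  · intro k hk
    rw [hd (p - q + k) (by omega), ← hper k]
    congr 1; omega
  · rw [← hper (d - (p - q))]
    convert hdl using 2 <;> omega

lemma IsLyndon.le_of_window_eq [LinearOrder α] {x y : ℕ → α} {p q i n : ℕ} (hx : IsLyndon x p)
    (hy : y.Periodic q) (hq : 0 < q) (hpn : p ≤ n) (h : window x 0 n = window y i n) : p ≤ q := by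
  by_contra! hc
  rw [window_eq_window_iff] at h
  refine hx.not_border hq hc fun k hk => ?_
  have h1 := h k (by omega)
  have h2 := h (q + k) (by omega)
  simp only [zero_add] at h1 h2
  rw [h1, h2, ← hy]
  congr 1; omega

lemma Periodic.eq_of_window_eq {x y : ℕ → α} {p n i k : ℕ} (hp : 0 < p) (hx : x.Periodic p)
    (hy : y.Periodic p) (hpn : p ≤ n) (h : window x i n = window y k n) :
    ∀ t, x (i + t) = y (k + t) := by
  rw [window_eq_window_iff] at h
  intro t
  have := h (t % p) ((Nat.mod_lt _ hp).trans_le hpn)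
  rw [← hx.map_mod_nat, ← hy.map_mod_nat] at this ⊢
  simpa using this

/-- Two Lyndon words of the same period, one a shift of the other, coincide. -/
lemma IsLyndon.eq_of_shift [LinearOrder α] {x y : ℕ → α} {p i : ℕ} (hx : IsLyndon x p)
    (hy : IsLyndon y p) (h : ∀ t, x t = y (i + t)) : x = y := by
  have hp := hx.1
  have h' : ∀ t, x t = y (i % p + t) := fun t => by
    rw [h, ← hy.2.1.map_mod_nat, ← hy.2.1.map_mod_nat (i % p + t)]; simp
  rcases Nat.eq_zero_or_pos (i % p) with h0 | h0
  · funext t; simpa [h0] using h' t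
  have hlt := Nat.mod_lt i hp
  have h1 := hy.2.2 _ h0 hlt
  have h2 := hx.2.2 (p - i % p) (by omega) (by omega)
  refine absurd (h1.trans_eq ?_) (lt_asymm (h2.trans_eq ?_))
  · exact congrArg toLex (funext fun t => (h' t).symm)
  · refine congrArg toLex (funext fun t => ?_)
    rw [h', ← hy.2.1 t]
    congr 1; omega

lemma injOn_circuits [LinearOrder α] (w : List α) (n : ℕ) :
    Set.InjOn (fun c => window c.1 0 (n + 1)) (circuits w n) := by
  rintro ⟨x, p⟩ ⟨hx, hp, -⟩ ⟨y, q⟩ ⟨hy, hq, -⟩ h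
  dsimp only at *
  obtain rfl : p = q := le_antisymm
    (hx.le_of_window_eq hy.2.1 hy.1 (by omega) h)
    (hy.le_of_window_eq hx.2.1 hx.1 (by omega) h.symm)
  have := Periodic.eq_of_window_eq hx.1 hx.2.1 hy.2.1 (by omega) h
  simp only [zero_add] at this
  rw [funext this]

/-- After removal of one edge from each small circuit, the Rauzy graph remains connected. -/
lemma eq_of_forall_not_circuit [LinearOrder α] {β : Type*} (w : List α) (n : ℕ) (h : List α → β)
    (hE : ∀ e ∈ factors w (n + 1) \ (fun c => window c.1 0 (n + 1)) '' circuits w n,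
      h (e.take n) = h e.tail) :
    ∀ v ∈ factors w n, h v = h (w.take n) := by
  have hcirc : ∀ p x, (x, p) ∈ circuits w n → h (window x 0 n) = h (window x 1 n) := by
    intro p
    induction p using Nat.strong_induction_on with
    | _ p ih =>
    intro x hx
    obtain ⟨hL, hpn, hw⟩ := id hx
    dsimp only at hL hpn hw
    have step : ∀ i, 0 < i → i < p → h (window x i n) = h (window x (i + 1) n) := by
      intro i hi hip
      by_cases hc : window x i (n + 1) ∈ (fun c => window c.1 0 (n + 1)) '' circuits w n
      · obtain ⟨⟨y, q⟩, hy, hyx⟩ := hc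
        dsimp only at hyx
        have hqp : q ≤ p := hy.1.le_of_window_eq hL.2.1 hL.1 (Nat.le_succ_of_le hy.2.1) hyx
        rcases hqp.lt_or_eq with hlt | rfl
        · have := ih q hlt y hy
          rwa [← window_take, ← window_tail, hyx, window_take, window_tail] at this
        · have hs := Periodic.eq_of_window_eq hL.1 hy.1.2.1 hL.2.1 (by omega) hyx
          simp only [zero_add] at hs
          obtain rfl := hy.1.eq_of_shift hL hs
          exact absurd (congrArg toLex (funext hs)) (hL.2.2 i hi hip).ne
      · have := hE _ ⟨⟨hw i, by simp⟩, hc⟩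
        rwa [window_take, window_tail] at this
    have chain : ∀ i, 1 ≤ i → i ≤ p → h (window x 1 n) = h (window x i n) := by
      intro i hi
      induction i, hi using Nat.le_induction with
      | base => intro _; rfl
      | succ i hi ih' => intro hip; rw [ih' (by omega), step i hi (by omega)]
    rw [chain p hL.1 le_rfl,
      window_congr_mod hL.2.1 (show 0 ≡ p [MOD p] by simp [Nat.ModEq])]
  have hall : ∀ e ∈ factors w (n + 1), h (e.take n) = h e.tail := by
    intro e he
    by_cases hc : e ∈ (fun c => window c.1 0 (n + 1)) '' circuits w n
    · obtain ⟨⟨x, p⟩, hx, rfl⟩ := hc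
      simpa only [window_take, window_tail] using hcirc p x hx
    · exact hE e ⟨he, hc⟩
  have hwalk : ∀ s, s + n ≤ w.length → h ((w.drop s).take n) = h (w.take n) := by
    intro s
    induction s with
    | zero => simp
    | succ s ih =>
      intro hs
      rw [← ih (by omega)]
      have := hall ((w.drop s).take (n + 1))
        ⟨(List.take_prefix _ _).isInfix.trans (List.drop_suffix _ _).isInfix,
          by simp; omega⟩
      rw [List.take_take, min_eq_left (by omega)] at this
      rw [this, ← List.drop_one, List.drop_take, List.drop_drop]
      simp
  rintro v ⟨⟨s, t, rfl⟩, rfl⟩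
  simpa using hwalk s.length (by simp)

lemma ncard_circuits_add_le [LinearOrder α] (w : List α) (n : ℕ) :
    (circuits w n).ncard + (factors w n).ncard ≤ (factors w (n + 1)).ncard + 1 := by
  set f : (ℕ → α) × ℕ → List α := fun c => window c.1 0 (n + 1) with hf
  set E := factors w (n + 1) \ f '' circuits w n with hE
  have himg : f '' circuits w n ⊆ factors w (n + 1) := by
    rintro _ ⟨c, hc, rfl⟩
    exact ⟨hc.2.2 0, by simp [hf]⟩
  have hcard : E.ncard + (circuits w n).ncard = (factors w (n + 1)).ncard := by
    rw [← (injOn_circuits w n).ncard_image]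
    exact Set.ncard_sdiff_add_ncard_of_subset himg (finite_factors _ _)
  suffices (factors w n).ncard ≤ E.ncard + 1 by omega
  have : Finite (factors w n) := finite_factors w n
  have : Finite E := (finite_factors w (n + 1)).subset Set.sdiff_subset
  have := Fintype.ofFinite (factors w n)
  have := Fintype.ofFinite E
  have hsrc (e : E) : e.1.take n ∈ factors w n :=
    ⟨(List.take_prefix _ _).isInfix.trans e.2.1.1, by simp [e.2.1.2]⟩
  have htgt (e : E) : e.1.tail ∈ factors w n :=
    ⟨(List.tail_suffix _).isInfix.trans e.2.1.1, by simp [e.2.1.2]⟩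
  rcases (factors w n).eq_empty_or_nonempty with h0 | ⟨v₀, hv₀⟩
  · simp [h0]
  let L : (factors w n → ℚ) →ₗ[ℚ] (E → ℚ) × ℚ :=
    (LinearMap.pi fun e => LinearMap.proj ⟨_, hsrc e⟩ - LinearMap.proj ⟨_, htgt e⟩).prod
      (LinearMap.proj ⟨v₀, hv₀⟩)
  have hL : Function.Injective L := by
    rw [injective_iff_map_eq_zero]
    intro g hg
    have h1 : ∀ e : E, g ⟨_, hsrc e⟩ = g ⟨_, htgt e⟩ := fun e => by
      simpa [L, sub_eq_zero] using congrFun (congrArg Prod.fst hg) e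
    have h2 : g ⟨v₀, hv₀⟩ = 0 := by simpa [L] using congrArg Prod.snd hg
    set h : List α → ℚ := Function.extend Subtype.val g 0 with hh
    have hext : ∀ v : factors w n, h v = g v := fun v =>
      Subtype.val_injective.extend_apply g 0 v
    have hconst := eq_of_forall_not_circuit w n h fun e he => by
      rw [hext ⟨_, hsrc ⟨e, he⟩⟩, hext ⟨_, htgt ⟨e, he⟩⟩]
      exact h1 ⟨e, he⟩
    funext v
    rw [← hext v, hconst v v.2, ← hconst v₀ hv₀, hext ⟨v₀, hv₀⟩, h2]
    rfl
  have := LinearMap.finrank_le_finrank_of_injective hL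
  rw [Module.finrank_prod, Module.finrank_fintype_fun_eq_card, Module.finrank_fintype_fun_eq_card,
    Module.finrank_self, ← Nat.card_eq_fintype_card, ← Nat.card_eq_fintype_card,
    Nat.card_coe_set_eq, Nat.card_coe_set_eq] at this
  exact this

lemma sum_ncard_circuits_le [LinearOrder α] (w : List α) :
    ∀ N, 1 ≤ N → ∑ n ∈ Finset.Ico 1 N, (circuits w n).ncard + (factors w 1).ncard + 1
      ≤ (factors w N).ncard + N := by
  intro N hN
  induction N, hN using Nat.le_induction with
  | base => simp
  | succ N hN ih =>
    rw [Finset.sum_Ico_succ_top hN]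
    have := ncard_circuits_add_le w N
    omega

lemma finite_circuits [LinearOrder α] (w : List α) (n : ℕ) : (circuits w n).Finite := by
  refine Set.Finite.of_finite_image ((finite_factors w (n + 1)).subset ?_) (injOn_circuits w n)
  rintro _ ⟨c, hc, rfl⟩
  exact ⟨hc.2.2 0, by simp⟩

lemma exists_mem_modEq {S : Finset ℕ} {p : ℕ} (hS : S ⊆ Finset.range p) (hne : S.Nonempty)
    (i : ℕ) : ∃ s ∈ S, ∃ k, k + S.card ≤ p ∧ s + k ≡ i [MOD p] := by
  have hm : 0 < S.card := hne.card_pos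
  have hmp : S.card ≤ p := by simpa using Finset.card_le_card hS
  set T := (Finset.range (p - S.card + 1)).image fun k => (i + (p - k)) % p with hT
  have hTc : T.card = p - S.card + 1 := by
    rw [hT, Finset.card_image_of_injOn, Finset.card_range]
    intro a ha b hb hab
    simp only [Finset.coe_range, Set.mem_Iio] at ha hb
    have h1 : p - a ≡ p - b [MOD p] := Nat.ModEq.add_left_cancel' i hab
    have h2 : p + b ≡ p + a [MOD p] := by
      convert (h1.add_right (a + b)) using 1 <;> omega
    exact ((Nat.ModEq.add_left_cancel' p h2).eq_of_lt_of_lt (by omega) (by omega)).symm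
  have hTs : T ⊆ Finset.range p := by
    intro t ht
    obtain ⟨k, -, rfl⟩ := Finset.mem_image.1 ht
    exact Finset.mem_range.2 (Nat.mod_lt _ (by omega))
  obtain ⟨s, hs⟩ : (S ∩ T).Nonempty := by
    refine Finset.inter_nonempty_of_card_lt_card_add_card hS hTs ?_
    rw [Finset.card_range]; omega
  obtain ⟨hsS, hsT⟩ := Finset.mem_inter.1 hs
  obtain ⟨k, hk, rfl⟩ := Finset.mem_image.1 hsT
  have hk := Finset.mem_range.1 hk
  refine ⟨_, hsS, k, by omega, ?_⟩
  have : (i + (p - k)) % p + k ≡ i + (p - k) + k [MOD p] := (Nat.mod_modEq _ _).add_right k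
  refine this.trans ?_
  rw [show i + (p - k) + k = i + p by omega]
  simp [Nat.ModEq]

open Classical in
/-- The `j`-powers in the conjugacy class of a given periodic word are controlled by the orders of
the Rauzy graphs in which the corresponding circuit occurs. -/
lemma mul_card_powers_le {x : ℕ → α} {p j : ℕ} (hp : 0 < p) (hx : x.Periodic p) (hj : 2 ≤ j)
    (w : List α) :
    (j - 1) * ((Finset.Icc 1 w.length ×ˢ Finset.range p).filter
        fun q => window x q.2 (q.1 * p * j) <:+: w).card ≤
      ((Finset.Ico 1 w.length).filter
        fun n => p ≤ n ∧ ∀ i, window x i (n + 1) <:+: w).card := by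
  set P := (Finset.Icc 1 w.length ×ˢ Finset.range p).filter
        fun q => window x q.2 (q.1 * p * j) <:+: w with hP
  rcases P.eq_empty_or_nonempty with h0 | hne
  · simp [h0]
  obtain ⟨⟨A, i₀⟩, hAP, hmax⟩ := P.exists_max_image Prod.fst hne
  dsimp only at hmax
  set S := (Finset.range p).filter fun i => window x i (A * p * j) <:+: w with hS
  have hA := hAP
  simp only [hP, Finset.mem_filter, Finset.mem_product, Finset.mem_Icc, Finset.mem_range] at hA
  have hSne : S.Nonempty := ⟨i₀, by simp [hS, hA]⟩
  have hSp : S ⊆ Finset.range p := Finset.filter_subset _ _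
  have hm : S.card ≤ p := by simpa using Finset.card_le_card hSp
  have hPle : P.card ≤ (A - 1) * p + S.card := by
    have hsub : P ⊆ (Finset.Ico 1 A ×ˢ Finset.range p) ∪ ({A} ×ˢ S) := by
      rintro ⟨a, i⟩ hai
      have hle := hmax _ hai
      simp only [hP, Finset.mem_filter, Finset.mem_product, Finset.mem_Icc,
        Finset.mem_range] at hai
      dsimp only at hle
      simp only [hS, Finset.mem_union, Finset.mem_filter, Finset.mem_product, Finset.mem_Ico,
        Finset.mem_range, Finset.mem_singleton]
      rcases hle.lt_or_eq with h | rfl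
      · exact Or.inl ⟨⟨hai.1.1.1, h⟩, hai.1.2⟩
      · exact Or.inr ⟨rfl, hai.1.2, hai.2⟩
    refine (Finset.card_le_card hsub).trans ((Finset.card_union_le _ _).trans ?_)
    simp
  have hNsub : Finset.Ico p (A * p * j - p + S.card) ⊆ (Finset.Ico 1 w.length).filter
        fun n => p ≤ n ∧ ∀ i, window x i (n + 1) <:+: w := by
    intro n hn
    obtain ⟨hpn, hn⟩ := Finset.mem_Ico.1 hn
    have hall : ∀ i, window x i (n + 1) <:+: w := by
      intro i
      obtain ⟨s, hs, k, hk, hsk⟩ := exists_mem_modEq hSp hSne i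
      rw [← window_congr_mod hx hsk]
      exact (window_infix x (by omega)).trans (Finset.mem_filter.1 hs).2
    have hlen := (hall 0).length_le
    rw [length_window] at hlen
    exact Finset.mem_filter.2 ⟨Finset.mem_Ico.2 ⟨by omega, by omega⟩, hpn, hall⟩
  refine le_trans ?_ (Finset.card_le_card hNsub)
  rw [Nat.card_Ico]
  refine (Nat.mul_le_mul_left _ hPle).trans ?_
  obtain ⟨a, rfl⟩ := Nat.exists_eq_add_of_le' hA.1.1.1
  obtain ⟨b, rfl⟩ := Nat.exists_eq_add_of_le' hj
  have h1 : (a + 1) * p * (b + 2) = a * p * b + 2 * (a * p) + p * b + 2 * p := by ring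
  have h2 : (b + 2 - 1) * ((a + 1 - 1) * p + S.card)
      = a * p * b + a * p + b * S.card + S.card := by
    simp only [Nat.add_sub_cancel, show b + 2 - 1 = b + 1 by omega]; ring
  have h3 : b * S.card ≤ p * b := by rw [mul_comm p]; exact Nat.mul_le_mul_left _ hm
  rw [h1, h2]
  omega

lemma flatten_replicate_eq_window (u : List α) {x : ℕ → α} (hx : x.Periodic u.length)
    (hu : u = window x 0 u.length) (j : ℕ) :
    (List.replicate j u).flatten = window x 0 (u.length * j) := by
  induction j with
  | zero => simp [window]
  | succ j ih =>
    rw [List.replicate_succ', List.flatten_append, ih, Nat.mul_succ]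
    simp only [List.flatten_cons, List.flatten_nil, List.append_nil]
    have : u = window x (u.length * j) u.length := by
      conv_lhs => rw [hu]
      exact window_congr_mod hx (by simp [Nat.ModEq]) _
    conv_lhs => rw [this]
    simp only [window, ← List.map_append]
    congr 1
    simp [← List.range'_append_1]

/-- Every periodic word is a shift of a Lyndon word whose period divides the given one. -/
lemma exists_isLyndon [LinearOrder α] {x : ℕ → α} {m : ℕ} (hm : 0 < m) (hx : x.Periodic m) :
    ∃ y p i, IsLyndon y p ∧ p ∣ m ∧ i < p ∧ ∀ t, x t = y (i + t) := by
  classical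
  have hex : ∃ p, 0 < p ∧ x.Periodic p := ⟨m, hm, hx⟩
  set p := Nat.find hex
  obtain ⟨hp, hper⟩ : 0 < p ∧ x.Periodic p := Nat.find_spec hex
  have hmin : ∀ q, 0 < q → q < p → ¬ x.Periodic q := fun q hq hqp h =>
    Nat.find_min hex hqp ⟨hq, h⟩
  have hdvd : p ∣ m := by
    by_contra hnd
    refine hmin (m % p) (Nat.pos_of_ne_zero fun h => hnd (Nat.dvd_of_mod_eq_zero h))
      (Nat.mod_lt _ hp) fun t => ?_
    rw [← hx t, ← hper.map_mod_nat, ← hper.map_mod_nat (t + m)]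
    simp
  obtain ⟨i, hi, himin⟩ := (Finset.range p).exists_min_image
    (fun i => toLex fun k => x (i + k)) ⟨0, by simpa using hp⟩
  have hi := Finset.mem_range.1 hi
  have hshift : ∀ t, x (i + ((p - i) + t)) = x t := fun t => by
    rw [← hper t]; congr 1; omega
  refine ⟨fun k => x (i + k), p, (p - i) % p, ⟨hp, fun t => ?_, fun k hk hkp => ?_⟩, hdvd,
    Nat.mod_lt _ hp, fun t => ?_⟩
  · change x (i + (t + p)) = _
    rw [← add_assoc, hper]
  · refine lt_of_le_of_ne ?_ fun heq => hmin k hk hkp fun t => ?_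
    · convert himin ((i + k) % p) (Finset.mem_range.2 (Nat.mod_lt _ hp)) using 3 with t
      change x (i + (k + t)) = _
      rw [← hper.map_mod_nat, ← hper.map_mod_nat ((i + k) % p + t)]
      simp [add_assoc]
    · have := congrFun (toLex.injective heq) ((p - i) + t)
      rw [hshift] at this
      rw [this, ← hshift (t + k)]
      congr 1; omega
  · change x t = x (i + ((p - i) % p + t))
    rw [← hshift t, ← hper.map_mod_nat, ← hper.map_mod_nat (i + ((p - i) % p + t))]
    congr 1
    exact Nat.ModEq.add_left i ((Nat.mod_modEq _ _).symm.add_right t)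

lemma exists_window_eq_of_power [LinearOrder α] {u : List α} (hu : u ≠ []) (j : ℕ) :
    ∃ y p i a, IsLyndon y p ∧ 0 < a ∧ i < p ∧
      (List.replicate j u).flatten = window y i (a * p * j) := by
  have hlen : 0 < u.length := List.length_pos_iff.2 hu
  let x : ℕ → α := fun k => u[k % u.length]'(Nat.mod_lt _ hlen)
  have hx : x.Periodic u.length := fun k => by simp [x]
  have hux : u = window x 0 u.length := by
    apply List.ext_getElem (by simp)
    intro k hk _
    simp [window, x, Nat.mod_eq_of_lt hk]
  obtain ⟨y, p, i, hy, ⟨a, ha⟩, hi, hxy⟩ := exists_isLyndon hlen hx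
  refine ⟨y, p, i, a, hy, Nat.pos_of_ne_zero ?_, hi, ?_⟩
  · rintro rfl; omega
  · rw [flatten_replicate_eq_window u hx hux, ha, mul_comm p, window_eq_window_iff]
    intro t _
    rw [zero_add, hxy]

open Classical in
lemma mul_numPowersExp_le_sum [LinearOrder α] (w : List α) {j : ℕ} (hj : 2 ≤ j) :
    (j - 1) * numPowersExp j w ≤ ∑ n ∈ Finset.Ico 1 w.length, (circuits w n).ncard := by
  set I : Finset ((ℕ → α) × ℕ) :=
    (Finset.Ico 1 w.length).biUnion fun n => (finite_circuits w n).toFinset with hI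
  let P : (ℕ → α) × ℕ → Finset (ℕ × ℕ) := fun c =>
    (Finset.Icc 1 w.length ×ˢ Finset.range c.2).filter
      fun q => window c.1 q.2 (q.1 * c.2 * j) <:+: w
  have hPle : ∀ c, IsLyndon c.1 c.2 → (j - 1) * (P c).card ≤
      ((Finset.Ico 1 w.length).filter fun n => c ∈ circuits w n).card := by
    intro c hc
    convert mul_card_powers_le hc.1 hc.2.1 hj w using 3
    · ext q; simp [P]
    · simp [circuits, hc]
  have hIL : ∀ c ∈ I, IsLyndon c.1 c.2 := by
    intro c hc
    obtain ⟨n, -, hn⟩ := Finset.mem_biUnion.1 hc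
    exact ((finite_circuits w n).mem_toFinset.1 hn).1
  have hQ : numPowersExp j w ≤ ∑ c ∈ I, (P c).card := by
    have hsub : {v : List α | v <:+: w ∧
        ∃ u : List α, u ≠ [] ∧ v = (List.replicate j u).flatten} ⊆
        ↑(I.biUnion fun c => (P c).image fun q => window c.1 q.2 (q.1 * c.2 * j)) := by
      rintro v ⟨hvw, u, hu, rfl⟩
      obtain ⟨y, p, i, a, hy, ha, hi, hv⟩ := exists_window_eq_of_power hu j
      rw [hv] at hvw ⊢
      have hP : (a, i) ∈ P (y, p) := by
        have hlen := hvw.length_le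
        rw [length_window, mul_assoc] at hlen
        have : a ≤ a * (p * j) := Nat.le_mul_of_pos_right _ (Nat.mul_pos hy.1 (by omega))
        simp only [P, Finset.mem_filter, Finset.mem_product, Finset.mem_Icc, Finset.mem_range]
        exact ⟨⟨⟨ha, by omega⟩, hi⟩, hvw⟩
      obtain ⟨n, hn⟩ := Finset.card_pos.1 (lt_of_lt_of_le
        (Nat.mul_pos (by omega : 0 < j - 1) (Finset.card_pos.2 ⟨_, hP⟩)) (hPle (y, p) hy))
      obtain ⟨hn, hc⟩ := Finset.mem_filter.1 hn
      rw [Finset.mem_coe, Finset.mem_biUnion]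
      exact ⟨(y, p), Finset.mem_biUnion.2 ⟨n, hn, by simpa using hc⟩,
        Finset.mem_image.2 ⟨(a, i), hP, rfl⟩⟩
    refine (Set.ncard_le_ncard hsub (Finset.finite_toSet _)).trans ?_
    rw [Set.ncard_coe_finset]
    exact Finset.card_biUnion_le.trans (Finset.sum_le_sum fun c _ => Finset.card_image_le)
  calc (j - 1) * numPowersExp j w
      ≤ ∑ c ∈ I, (j - 1) * (P c).card := by
        rw [← Finset.mul_sum]; exact Nat.mul_le_mul_left _ hQ
    _ ≤ ∑ c ∈ I, ((Finset.Ico 1 w.length).filter fun n => c ∈ circuits w n).card :=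
        Finset.sum_le_sum fun c hc => hPle c (hIL c hc)
    _ = ∑ n ∈ Finset.Ico 1 w.length, (I.filter fun c => c ∈ circuits w n).card :=
        Finset.sum_card_bipartiteAbove_eq_sum_card_bipartiteBelow _
    _ = ∑ n ∈ Finset.Ico 1 w.length, (circuits w n).ncard := by
        refine Finset.sum_congr rfl fun n hn => ?_
        rw [← Set.ncard_coe_finset]
        congr 1
        ext c
        simp only [Finset.coe_filter, Set.mem_ofPred_eq, and_iff_right_iff_imp]
        exact fun hc => Finset.mem_biUnion.2 ⟨n, hn, by simpa using hc⟩

lemma card_toFinset_le_ncard_factors [DecidableEq α] (w : List α) :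
    w.toFinset.card ≤ (factors w 1).ncard := by
  rw [← Set.ncard_coe_finset,
    ← Set.ncard_image_of_injective _ (List.singleton_injective (α := α))]
  refine Set.ncard_le_ncard ?_ (finite_factors w 1)
  rintro _ ⟨a, ha, rfl⟩
  obtain ⟨s, t, rfl⟩ := List.append_of_mem (List.mem_toFinset.1 ha)
  exact ⟨⟨s, t, by simp⟩, rfl⟩

lemma ncard_factors_length_le (w : List α) : (factors w w.length).ncard ≤ 1 := by
  rw [← Set.ncard_singleton w]
  exact Set.ncard_le_ncard fun v hv => hv.1.eq_of_length hv.2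

end KPowers

theorem k_power_count_bound {α : Type*} [DecidableEq α] (w : List α) (j : ℕ) (hj : 2 ≤ j) :
    (j - 1) * numPowersExp j w ≤ w.length - w.toFinset.card := by
  let _ : LinearOrder α := IsWellOrder.linearOrder WellOrderingRel
  have h := KPowers.mul_numPowersExp_le_sum w hj
  rcases Nat.eq_zero_or_pos w.length with h0 | h0
  · simp_all
  · have h1 := KPowers.sum_ncard_circuits_le w w.length h0
    have h2 := KPowers.card_toFinset_le_ncard_factors w
    have h3 := KPowers.ncard_factors_length_le w
    omega
end
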